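/- arXiv:1607.05668 — 4 statements merged into one kernel-verified Lean document; each statement's English description precedes it below -/
import Mathlib

section
/- Borell-Brascamp-Lieb inequality: Let n ≥ 1, let 0 < λ < 1 and −1/n ≤ p ≤ +∞, and let f, g, h ∈ L¹(ℝⁿ) be nonnegative functions such that h((1−λ)x + λy) ≥ M_p(f(x), g(y); λ) for every x, y ∈ ℝⁿ. Then ∫_{ℝⁿ} h dx ≥ M_{p/(np+1)}(∫_{ℝⁿ} f dx, ∫_{ℝⁿ} g dx; λ), where the index p/(np+1) is interpreted as −∞ when p = −1/n and as 1/n when p = +∞. -/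
open MeasureTheory

/-- The `λ`-weighted `q`-mean of two nonnegative numbers `a, b`, for an extended real
index `q ∈ ℝ ∪ {±∞}`: it is `0` if `ab = 0`, and otherwise it equals
`((1−λ)a^q + λb^q)^{1/q}` for `q ∈ ℝ \ {0}`, `a^{1−λ}b^λ` for `q = 0`,
`max{a,b}` for `q = +∞` and `min{a,b}` for `q = −∞`. -/
noncomputable def genMean (q : EReal) (lam a b : ℝ) : ℝ :=
  if a = 0 ∨ b = 0 then 0
  else if q = ⊤ then max a b
  else if q = ⊥ then min a b
  else if q = 0 then a ^ (1 - lam) * b ^ lam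
  else ((1 - lam) * a ^ q.toReal + lam * b ^ q.toReal) ^ (1 / q.toReal)

/-- The index `p/(np+1)`, interpreted as `−∞` when `p = −1/n` and as `1/n` when
`p = +∞`. -/
noncomputable def bblIndex (n : ℕ) (p : EReal) : EReal :=
  if p = ⊤ then (((1 : ℝ) / n : ℝ) : EReal)
  else if p = ((-(1 / n) : ℝ) : EReal) then ⊥
  else ((p.toReal / (n * p.toReal + 1) : ℝ) : EReal)

open scoped NNReal ENNReal

section GenMean

variable {lam : ℝ} {q : EReal}

theorem EReal.toReal_ne_zero_of_ne (h1 : q ≠ ⊤) (h2 : q ≠ ⊥) (h3 : q ≠ 0) : q.toReal ≠ 0 := by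
  simp [EReal.toReal_eq_zero_iff, h1, h2, h3]

theorem genMean_zero_left (q : EReal) (lam b : ℝ) : genMean q lam 0 b = 0 := by
  simp [genMean]

theorem genMean_zero_right (q : EReal) (lam a : ℝ) : genMean q lam a 0 = 0 := by
  simp [genMean]

theorem genMean_nonneg (hlam : lam ∈ Set.Ioo (0 : ℝ) 1) (q : EReal) {a b : ℝ}
    (ha : 0 ≤ a) (hb : 0 ≤ b) : 0 ≤ genMean q lam a b := by
  have h1 : 0 < 1 - lam := sub_pos.2 hlam.2
  have h2 := hlam.1
  unfold genMean
  split_ifs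
  · rfl
  · positivity
  · positivity
  · positivity
  · positivity

theorem genMean_pos (hlam : lam ∈ Set.Ioo (0 : ℝ) 1) (q : EReal) {a b : ℝ}
    (ha : 0 < a) (hb : 0 < b) : 0 < genMean q lam a b := by
  have h1 : 0 < 1 - lam := sub_pos.2 hlam.2
  have h2 := hlam.1
  unfold genMean
  split_ifs with h
  · rcases h with h | h <;> linarith
  · positivity
  · positivity
  · positivity
  · positivity

theorem genMean_mono (hlam : lam ∈ Set.Ioo (0 : ℝ) 1) (q : EReal) {a b a' b' : ℝ}
    (ha : 0 ≤ a) (hb : 0 ≤ b) (haa : a ≤ a') (hbb : b ≤ b') :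
    genMean q lam a b ≤ genMean q lam a' b' := by
  have h1 : 0 < 1 - lam := sub_pos.2 hlam.2
  have h2 := hlam.1
  rcases ha.eq_or_lt with rfl | ha
  · simpa [genMean_zero_left] using genMean_nonneg hlam q haa (hb.trans hbb)
  rcases hb.eq_or_lt with rfl | hb
  · simpa [genMean_zero_right] using genMean_nonneg hlam q (ha.le.trans haa) hbb
  have ha' := ha.trans_le haa
  have hb' := hb.trans_le hbb
  simp only [genMean, ha.ne', hb.ne', ha'.ne', hb'.ne', or_self, if_false]
  split_ifs with hT hB h0
  · exact max_le_max haa hbb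
  · exact min_le_min haa hbb
  · gcongr
  · rcases (EReal.toReal_ne_zero_of_ne hT hB h0).lt_or_gt with hr | hr
    · refine Real.rpow_le_rpow_of_nonpos (by positivity) ?_ (one_div_nonpos.2 hr.le)
      gcongr ?_ * ?_ + ?_ * ?_
      · exact Real.rpow_le_rpow_of_nonpos ha haa hr.le
      · exact Real.rpow_le_rpow_of_nonpos hb hbb hr.le
    · gcongr

theorem genMean_mul (hlam : lam ∈ Set.Ioo (0 : ℝ) 1) (q : EReal) {a b c : ℝ}
    (hc : 0 ≤ c) (ha : 0 ≤ a) (hb : 0 ≤ b) :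
    genMean q lam (c * a) (c * b) = c * genMean q lam a b := by
  have h1 : 0 < 1 - lam := sub_pos.2 hlam.2
  have h2 := hlam.1
  rcases hc.eq_or_lt with rfl | hc
  · simp [genMean_zero_left]
  by_cases hab : a = 0 ∨ b = 0
  · simp [genMean, hab, hc.ne']
  have hab' : ¬ (c * a = 0 ∨ c * b = 0) := by simpa [hc.ne'] using hab
  simp only [genMean, hab, hab', if_false]
  split_ifs with hT hB h0
  · exact (mul_max_of_nonneg _ _ hc.le).symm
  · exact (mul_min_of_nonneg _ _ hc.le).symm
  · rw [Real.mul_rpow hc.le ha, Real.mul_rpow hc.le hb]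
    have : c ^ (1 - lam) * c ^ lam = c := by
      rw [← Real.rpow_add hc]; simp
    linear_combination (a ^ (1 - lam) * b ^ lam) * this
  · have hr := EReal.toReal_ne_zero_of_ne hT hB h0
    rw [Real.mul_rpow hc.le ha, Real.mul_rpow hc.le hb,
      show (1 - lam) * (c ^ q.toReal * a ^ q.toReal) + lam * (c ^ q.toReal * b ^ q.toReal)
        = c ^ q.toReal * ((1 - lam) * a ^ q.toReal + lam * b ^ q.toReal) by ring,
      Real.mul_rpow (by positivity) (by positivity), ← Real.rpow_mul hc.le,
      mul_one_div_cancel hr, Real.rpow_one]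

/-- The weighted power mean of exponent `s < 1` is at most the arithmetic mean. -/
theorem rpow_mean_le_arith_mean {s w₁ w₂ x y : ℝ} (hs : s < 1) (hs0 : s ≠ 0)
    (hw₁ : 0 < w₁) (hw₂ : 0 < w₂) (hw : w₁ + w₂ = 1) (hx : 0 < x) (hy : 0 < y) :
    (w₁ * x ^ s + w₂ * y ^ s) ^ (1 / s) ≤ w₁ * x + w₂ * y := by
  have hm : 0 < w₁ * x + w₂ * y := by positivity
  have hinv : ((w₁ * x + w₂ * y) ^ s) ^ (1 / s) = w₁ * x + w₂ * y := by
    rw [← Real.rpow_mul hm.le, mul_one_div_cancel hs0, Real.rpow_one]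
  rw [← hinv]
  rcases hs0.lt_or_gt with h | h
  · refine Real.rpow_le_rpow_of_nonpos (by positivity) ?_ (one_div_nonpos.2 h.le)
    calc (w₁ * x + w₂ * y) ^ s ≤ (x ^ w₁ * y ^ w₂) ^ s :=
          Real.rpow_le_rpow_of_nonpos (by positivity)
            (Real.geom_mean_le_arith_mean2_weighted hw₁.le hw₂.le hx.le hy.le hw) h.le
      _ = (x ^ s) ^ w₁ * (y ^ s) ^ w₂ := by
          rw [Real.mul_rpow (by positivity) (by positivity), ← Real.rpow_mul hx.le,
            ← Real.rpow_mul hy.le, ← Real.rpow_mul hx.le, ← Real.rpow_mul hy.le,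
            mul_comm w₁, mul_comm w₂]
      _ ≤ _ := Real.geom_mean_le_arith_mean2_weighted hw₁.le hw₂.le (by positivity)
            (by positivity) hw
  · refine Real.rpow_le_rpow (by positivity) ?_ (by positivity)
    simpa using (Real.concaveOn_rpow h.le hs.le).2 (Set.mem_Ici.2 hx.le) (Set.mem_Ici.2 hy.le)
      hw₁.le hw₂.le hw

theorem rpow_mean_mul_le {r A B u v : ℝ} (hlam : lam ∈ Set.Ioo (0 : ℝ) 1) (hr : -1 < r)
    (hr0 : r ≠ 0) (hA : 0 < A) (hB : 0 < B) (hu : 0 < u) (hv : 0 < v) :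
    ((1 - lam) * (A * u) ^ (r / (r + 1)) + lam * (B * v) ^ (r / (r + 1))) ^ (1 / (r / (r + 1)))
      ≤ ((1 - lam) * A ^ r + lam * B ^ r) ^ (1 / r) * ((1 - lam) * u + lam * v) := by
  have h1 : 0 < 1 - lam := sub_pos.2 hlam.2
  have h2 := hlam.1
  have hr1 : 0 < r + 1 := by linarith
  set s := r / (r + 1) with hs
  have hs0 : s ≠ 0 := div_ne_zero hr0 hr1.ne'
  have hs1 : s < 1 := by rw [hs, div_lt_one hr1]; linarith
  set S := (1 - lam) * A ^ r + lam * B ^ r with hS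
  have hS0 : 0 < S := by positivity
  have key : ∀ {C w : ℝ}, 0 < C → 0 < w → (C * w) ^ s = C ^ r * (w / C ^ r) ^ s := by
    intro C w hC hw
    rw [Real.mul_rpow hC.le hw.le, Real.div_rpow hw.le (by positivity), ← Real.rpow_mul hC.le,
      mul_div_assoc', mul_comm (C ^ r), mul_div_assoc, ← Real.rpow_sub hC, mul_comm (C ^ s)]
    congr 2
    rw [hs]; field_simp; ring
  have hmean := rpow_mean_le_arith_mean hs1 hs0 (w₁ := (1 - lam) * A ^ r / S)
    (w₂ := lam * B ^ r / S) (x := u / A ^ r) (y := v / B ^ r) (by positivity) (by positivity)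
    (by rw [← add_div, ← hS, div_self hS0.ne']) (by positivity) (by positivity)
  have e1 : (1 - lam) * (A * u) ^ s + lam * (B * v) ^ s
      = S * ((1 - lam) * A ^ r / S * (u / A ^ r) ^ s + lam * B ^ r / S * (v / B ^ r) ^ s) := by
    rw [key hA hu, key hB hv]; field_simp
  have e2 : (1 - lam) * A ^ r / S * (u / A ^ r) + lam * B ^ r / S * (v / B ^ r)
      = ((1 - lam) * u + lam * v) / S := by field_simp
  have e3 : S ^ (1 / s) = S ^ (1 / r) * S := by
    rw [← Real.rpow_add_one hS0.ne']
    congr 1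
    rw [hs]; field_simp; ring
  rw [e2] at hmean
  rw [e1, Real.mul_rpow hS0.le (by positivity), e3, mul_assoc]
  gcongr
  calc _ ≤ S * (((1 - lam) * u + lam * v) / S) := by gcongr
    _ = _ := by field_simp

theorem genMean_coe (r : ℝ) {a b : ℝ} (ha : 0 < a) (hb : 0 < b) :
    genMean (r : EReal) lam a b = if r = 0 then a ^ (1 - lam) * b ^ lam
      else ((1 - lam) * a ^ r + lam * b ^ r) ^ (1 / r) := by
  simp [genMean, ha.ne', hb.ne']

theorem bblIndex_coe (n : ℕ) (r : ℝ) :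
    bblIndex n (r : EReal)
      = if r = -(1 / n) then ⊥ else ((r / (n * r + 1) : ℝ) : EReal) := by
  simp only [bblIndex, EReal.coe_ne_top, if_false, EReal.coe_eq_coe_iff, EReal.toReal_coe]

theorem bblIndex_top (n : ℕ) : bblIndex n ⊤ = ((1 / n : ℝ) : EReal) := by
  simp only [bblIndex, if_true]

theorem genMean_bblIndex_one_mul_le (hlam : lam ∈ Set.Ioo (0 : ℝ) 1) {p : EReal}
    (hp : ((-1 : ℝ) : EReal) ≤ p) {A B u v : ℝ} (hA : 0 < A) (hB : 0 < B) (hu : 0 < u)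
    (hv : 0 < v) :
    genMean (bblIndex 1 p) lam (A * u) (B * v)
      ≤ genMean p lam A B * ((1 - lam) * u + lam * v) := by
  have h1 : 0 < 1 - lam := sub_pos.2 hlam.2
  have h2 := hlam.1
  have hAu : 0 < A * u := by positivity
  have hBv : 0 < B * v := by positivity
  induction p with
  | bot => exact absurd (le_bot_iff.1 hp) (EReal.coe_ne_bot _)
  | top =>
    rw [bblIndex_top, genMean_coe _ hAu hBv]
    simp only [genMean, hA.ne', hB.ne', or_self, if_false, if_true, Nat.cast_one, div_one,
      one_ne_zero, Real.rpow_one]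
    nlinarith [mul_le_mul_of_nonneg_right (le_max_right A B) (mul_pos h2 hv).le,
      mul_le_mul_of_nonneg_right (le_max_left A B) (mul_pos h1 hu).le]
  | coe r =>
    have hr : -1 ≤ r := EReal.coe_le_coe_iff.1 hp
    rw [bblIndex_coe, genMean_coe _ hA hB]
    rcases hr.eq_or_lt with rfl | hr
    · have : (-1 : ℝ) ≠ 0 := by norm_num
      simp only [Nat.cast_one, div_one, if_true, this, if_false, genMean, hAu.ne', hBv.ne', or_self,
        bot_ne_top, Real.rpow_neg_one, div_neg]
      rw [inv_mul_eq_div, le_div_iff₀ (by positivity)]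
      have a1 : min (A * u) (B * v) ≤ A * u := min_le_left _ _
      have a2 : min (A * u) (B * v) ≤ B * v := min_le_right _ _
      calc _ = (1 - lam) * A⁻¹ * min (A * u) (B * v) + lam * B⁻¹ * min (A * u) (B * v) := by ring
        _ ≤ (1 - lam) * A⁻¹ * (A * u) + lam * B⁻¹ * (B * v) := by gcongr
        _ = _ := by field_simp
    · have hr1 : r + 1 ≠ 0 := by linarith
      rw [if_neg (by simpa using hr.ne'), genMean_coe _ hAu hBv]
      simp only [Nat.cast_one, one_mul, div_eq_zero_iff, hr1, or_false]
      split_ifs with h0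
      · rw [Real.mul_rpow hA.le hu.le, Real.mul_rpow hB.le hv.le]
        calc _ = A ^ (1 - lam) * B ^ lam * (u ^ (1 - lam) * v ^ lam) := by ring
          _ ≤ _ := by
            gcongr
            exact Real.geom_mean_le_arith_mean2_weighted h1.le h2.le hu.le hv.le (by ring)
      · exact rpow_mean_mul_le hlam hr h0 hA hB hu hv

theorem bblIndex_one_bblIndex {n : ℕ} (hn : 1 ≤ n) {p : EReal}
    (hp : ((-(1 / (n + 1 : ℕ)) : ℝ) : EReal) ≤ p) :
    ((-1 : ℝ) : EReal) ≤ bblIndex n p ∧ bblIndex 1 (bblIndex n p) = bblIndex (n + 1) p := by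
  have hn0 : (0 : ℝ) < n := by exact_mod_cast hn
  induction p with
  | bot => exact absurd (le_bot_iff.1 hp) (EReal.coe_ne_bot _)
  | top =>
    have h0 : (0 : ℝ) < 1 / n := by positivity
    rw [bblIndex_top, bblIndex_top, bblIndex_coe, EReal.coe_le_coe_iff,
      if_neg (by push_cast; linarith)]
    refine ⟨by linarith, ?_⟩
    congr 1
    push_cast
    field_simp
    ring
  | coe r =>
    have hr : -(1 / (n + 1 : ℝ)) ≤ r := by
      have := EReal.coe_le_coe_iff.1 hp
      push_cast at this
      exact this
    have hlt : 1 / (n + 1 : ℝ) < 1 / n := by gcongr; linarith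
    have hr' : r ≠ -(1 / n) := by intro h; linarith
    have hpos : 0 < n * r + 1 := by
      have : n * (-(1 / n : ℝ)) < n * r := by gcongr; linarith
      have e : n * (-(1 / n : ℝ)) = -1 := by field_simp
      linarith
    have hge : 0 ≤ (n + 1) * r + 1 := by
      have : (n + 1) * (-(1 / (n + 1) : ℝ)) ≤ (n + 1) * r := by gcongr
      have e : (n + 1) * (-(1 / (n + 1) : ℝ)) = -1 := by field_simp
      linarith
    rw [bblIndex_coe n, if_neg hr', bblIndex_coe, bblIndex_coe, EReal.coe_le_coe_iff,
      le_div_iff₀ hpos]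
    refine ⟨by linarith, ?_⟩
    have hiff : r / (n * r + 1) = -(1 / (1 : ℕ)) ↔ r = -(1 / (n + 1 : ℕ)) := by
      push_cast
      rw [div_eq_iff hpos.ne', ← neg_div ((n : ℝ) + 1), eq_div_iff (by positivity)]
      constructor <;> intro h <;> linarith
    by_cases h : r = -(1 / (n + 1 : ℕ))
    · rw [if_pos (hiff.2 h), if_pos h]
    · rw [if_neg (mt hiff.1 h), if_neg h]
      push_cast
      rw [one_mul, div_add_one hpos.ne', div_div_div_cancel_right₀ hpos.ne']
      congr 1
      ring

end GenMean

section Line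

variable {lam : ℝ}

open scoped Pointwise in
theorem volume_image_mul_add_const {c : ℝ} (hc : 0 ≤ c) (d : ℝ) (s : Set ℝ) :
    volume ((fun x => c * x + d) '' s) = ENNReal.ofReal c * volume s := by
  have : (fun x => c * x + d) '' s = (fun x => x + d) '' (c • s) := by
    rw [← Set.image_smul, Set.image_image]
    rfl
  rw [this, Set.image_add_right, measure_preimage_add_right, Measure.addHaar_smul]
  simp [abs_of_nonneg hc]

/-- The one-dimensional Brunn–Minkowski inequality for compact sets. -/
theorem IsCompact.volume_add_le_volume_of_combo_mem (hlam : lam ∈ Set.Ioo (0 : ℝ) 1)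
    {K L C : Set ℝ} (hK : IsCompact K) (hL : IsCompact L) (hK0 : K.Nonempty) (hL0 : L.Nonempty)
    (hC : ∀ a ∈ K, ∀ b ∈ L, (1 - lam) * a + lam * b ∈ C) :
    ENNReal.ofReal (1 - lam) * volume K + ENNReal.ofReal lam * volume L ≤ volume C := by
  have h1 : 0 < 1 - lam := sub_pos.2 hlam.2
  have h2 := hlam.1
  obtain ⟨a, haK, ha⟩ := hK.exists_isGreatest hK0
  obtain ⟨b, hbL, hb⟩ := hL.exists_isLeast hL0
  rw [← volume_image_mul_add_const h1.le (lam * b),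
    ← volume_image_mul_add_const h2.le ((1 - lam) * a), ← measure_union₀]
  · refine measure_mono ?_
    rintro _ (⟨x, hx, rfl⟩ | ⟨y, hy, rfl⟩)
    · exact hC x hx b hbL
    · simpa [add_comm] using hC a haK y hy
  · exact (hL.image (by fun_prop)).measurableSet.nullMeasurableSet
  · refine measure_mono_null (t := {(1 - lam) * a + lam * b}) ?_ Real.volume_singleton
    rintro _ ⟨⟨x, hx, rfl⟩, ⟨y, hy, hxy⟩⟩
    have e1 := mul_le_mul_of_nonneg_left (ha hx) h1.le
    have e2 := mul_le_mul_of_nonneg_left (hb hy) h2.le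
    simp only [Set.mem_singleton_iff] at hxy ⊢
    linarith

/-- The one-dimensional Brunn–Minkowski inequality. -/
theorem MeasurableSet.volume_add_le_volume_of_combo_mem (hlam : lam ∈ Set.Ioo (0 : ℝ) 1)
    {A B C : Set ℝ} (hA : MeasurableSet A) (hB : MeasurableSet B) (hA0 : A.Nonempty)
    (hB0 : B.Nonempty) (hC : ∀ a ∈ A, ∀ b ∈ B, (1 - lam) * a + lam * b ∈ C) :
    ENNReal.ofReal (1 - lam) * volume A + ENNReal.ofReal lam * volume B ≤ volume C := by
  obtain ⟨a, ha⟩ := hA0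
  obtain ⟨b, hb⟩ := hB0
  rw [hA.measure_eq_iSup_isCompact, hB.measure_eq_iSup_isCompact]
  simp only [ENNReal.mul_iSup, iSup_and']
  refine ENNReal.biSup_add_biSup_le' ⟨∅, by simp⟩ ⟨∅, by simp⟩ ?_
  rintro K ⟨hKA, hK⟩ L ⟨hLB, hL⟩
  refine le_trans ?_ ((hK.insert a).volume_add_le_volume_of_combo_mem hlam (hL.insert b)
    (Set.insert_nonempty _ _) (Set.insert_nonempty _ _)
    fun x hx y hy => hC x (Set.insert_subset ha hKA hx) y (Set.insert_subset hb hLB hy))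
  gcongr <;> exact Set.subset_insert _ _

end Line

section Functional

variable {lam : ℝ}

/-- The implication of the Borell–Brascamp–Lieb inequality on a measure space `E`, with index `p`
in the hypothesis and index `q` in the conclusion. -/
def SatisfiesBBL (E : Type*) [MeasureSpace E] [AddCommGroup E] [Module ℝ E] (lam : ℝ)
    (p q : EReal) : Prop :=
  ∀ f g : E → ℝ≥0, Measurable f → Measurable g → ∀ h : E → ℝ≥0∞, Measurable h →
    (∀ x y, ENNReal.ofReal (genMean p lam (f x) (g y)) ≤ h ((1 - lam) • x + lam • y)) →
    ENNReal.ofReal (genMean q lam (∫⁻ x, f x).toReal (∫⁻ x, g x).toReal) ≤ ∫⁻ x, h x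

theorem lintegral_level_le {f : ℝ → ℝ≥0} (hf : Measurable f) {A : ℝ} (hA : 0 < A) :
    ∫⁻ t in Set.Ioi (0 : ℝ), volume {x | t < f x / A} = ENNReal.ofReal A⁻¹ * ∫⁻ x, f x := by
  rw [← lintegral_eq_lintegral_meas_lt volume (Filter.Eventually.of_forall fun x => by positivity)
    (by fun_prop), ← lintegral_const_mul _ (by fun_prop)]
  refine lintegral_congr fun x => ?_
  rw [div_eq_inv_mul, ENNReal.ofReal_mul (by positivity), ENNReal.ofReal_coe_nnreal]

theorem satisfiesBBL_real_of_bounded (hlam : lam ∈ Set.Ioo (0 : ℝ) 1) {p : EReal}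
    (hp : ((-1 : ℝ) : EReal) ≤ p) {f g : ℝ → ℝ≥0} (hf : Measurable f) (hg : Measurable g)
    (hfb : BddAbove (Set.range f)) (hgb : BddAbove (Set.range g)) {h : ℝ → ℝ≥0∞}
    (hh : Measurable h)
    (H : ∀ x y, ENNReal.ofReal (genMean p lam (f x) (g y)) ≤ h ((1 - lam) • x + lam • y)) :
    ENNReal.ofReal (genMean (bblIndex 1 p) lam (∫⁻ x, f x).toReal (∫⁻ x, g x).toReal)
      ≤ ∫⁻ x, h x := by
  have h1 : 0 < 1 - lam := sub_pos.2 hlam.2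
  have h2 := hlam.1
  set F := (∫⁻ x, f x).toReal with hF
  set G := (∫⁻ x, g x).toReal with hG
  have hFn : 0 ≤ F := ENNReal.toReal_nonneg
  rcases hFn.eq_or_lt with hF0 | hF0
  · simp [← hF0, genMean_zero_left]
  have hGn : 0 ≤ G := ENNReal.toReal_nonneg
  rcases hGn.eq_or_lt with hG0 | hG0
  · simp [← hG0, genMean_zero_right]
  have sup_pos : ∀ {u : ℝ → ℝ≥0}, BddAbove (Set.range u) → 0 < (∫⁻ x, u x).toReal →
      0 < ⨆ x, u x := by
    intro u hu hu0
    by_contra hsup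
    have : ∀ x, u x = 0 := fun x => by simpa using (le_ciSup hu x).trans (not_lt.1 hsup)
    simp [this] at hu0
  set A : ℝ := ((⨆ x, f x : ℝ≥0) : ℝ) with hA
  set B : ℝ := ((⨆ x, g x : ℝ≥0) : ℝ) with hB
  have hA0 : 0 < A := NNReal.coe_pos.2 (sup_pos hfb hF0)
  have hB0 : 0 < B := NNReal.coe_pos.2 (sup_pos hgb hG0)
  have hfA : ∀ x, f x / A ≤ 1 := fun x => (div_le_one hA0).2 (NNReal.coe_le_coe.2 (le_ciSup hfb x))
  have hgB : ∀ x, g x / B ≤ 1 := fun x => (div_le_one hB0).2 (NNReal.coe_le_coe.2 (le_ciSup hgb x))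
  have level_nonempty : ∀ {u : ℝ → ℝ≥0} {t : ℝ}, 0 < ((⨆ x, u x : ℝ≥0) : ℝ) → 0 < t → t < 1 →
      {x | t < u x / ((⨆ x, u x : ℝ≥0) : ℝ)}.Nonempty := by
    intro u t hu ht0 ht1
    lift t to ℝ≥0 using ht0.le
    have : t * (⨆ x, u x) < ⨆ x, u x :=
      mul_lt_of_lt_one_left (NNReal.coe_pos.1 hu) (by exact_mod_cast ht1)
    obtain ⟨x, hx⟩ := exists_lt_of_lt_ciSup this
    exact ⟨x, (lt_div_iff₀ hu).2 (by exact_mod_cast hx)⟩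
  set M := genMean p lam A B with hM
  have hM0 : 0 < M := genMean_pos hlam p hA0 hB0
  -- `k` is `h / M` truncated at `1`.
  set k : ℝ → ℝ≥0 := fun x => (min (h x / ENNReal.ofReal M) 1).toNNReal with hk
  have hkm : Measurable k := by fun_prop
  have hkh : ∫⁻ x, k x ≤ (ENNReal.ofReal M)⁻¹ * ∫⁻ x, h x := by
    rw [← lintegral_const_mul _ hh]
    refine lintegral_mono fun x => ?_
    rw [hk, ENNReal.coe_toNNReal (by simp), mul_comm, ← div_eq_mul_inv]
    exact min_le_left _ _
  have hlevel : ∀ t ∈ Set.Ioi (0 : ℝ), ENNReal.ofReal (1 - lam) * volume {x | t < f x / A}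
      + ENNReal.ofReal lam * volume {x | t < g x / B} ≤ volume {x | t < k x / 1} := by
    intro t ht
    have ht0 : 0 < t := ht
    rcases lt_or_ge t 1 with ht1 | ht1
    · refine MeasurableSet.volume_add_le_volume_of_combo_mem hlam
        (measurableSet_lt measurable_const (by fun_prop))
        (measurableSet_lt measurable_const (by fun_prop))
        (level_nonempty hA0 ht0 ht1) (level_nonempty hB0 ht0 ht1) ?_
      intro x hx y hy
      simp only [Set.mem_ofPred_eq, div_one] at hx hy ⊢
      set m := min (f x / A) (g y / B) with hm
      have htm : t < m := lt_min hx hy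
      have hm1 : m ≤ 1 := (min_le_left _ _).trans (hfA x)
      have hm0 : 0 < m := ht0.trans htm
      have hmf : m * A ≤ f x := (le_div_iff₀ hA0).1 (min_le_left _ _)
      have hmg : m * B ≤ g y := (le_div_iff₀ hB0).1 (min_le_right _ _)
      have hmM : m * M ≤ genMean p lam (f x) (g y) := by
        rw [hM, ← genMean_mul hlam p hm0.le hA0.le hB0.le]
        exact genMean_mono hlam p (by positivity) (by positivity) hmf hmg
      have hmh : ENNReal.ofReal m ≤ min (h ((1 - lam) * x + lam * y) / ENNReal.ofReal M) 1 := by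
        refine le_min ?_ (by simpa using hm1)
        rw [ENNReal.le_div_iff_mul_le (by simp [hM0]) (by simp), ← ENNReal.ofReal_mul hm0.le]
        exact (ENNReal.ofReal_le_ofReal hmM).trans (H x y)
      have := ENNReal.toReal_mono (by simp) hmh
      rw [ENNReal.toReal_ofReal hm0.le] at this
      exact htm.trans_le this
    · have e1 : {x | t < f x / A} = ∅ :=
        Set.eq_empty_of_forall_notMem fun x hx => absurd (hfA x) (not_le.2 (ht1.trans_lt hx))
      have e2 : {x | t < g x / B} = ∅ :=
        Set.eq_empty_of_forall_notMem fun x hx => absurd (hgB x) (not_le.2 (ht1.trans_lt hx))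
      simp [e1, e2]
  have hint : ENNReal.ofReal ((1 - lam) * (F / A) + lam * (G / B)) ≤ ∫⁻ x, k x := by
    have hmeas : ∀ u : ℝ → ℝ, Measurable fun t : ℝ => volume {x | t < u x} := fun u =>
      Antitone.measurable fun s t hst => measure_mono fun x hx => hst.trans_lt hx
    have := setLIntegral_mono (μ := volume) (hmeas _) hlevel
    rw [lintegral_add_left ((hmeas _).const_mul _), lintegral_const_mul _ (hmeas _),
      lintegral_const_mul _ (hmeas _), lintegral_level_le hf hA0, lintegral_level_le hg hB0,
      lintegral_level_le hkm one_pos] at this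
    have hFt : ENNReal.ofReal F = ∫⁻ x, f x :=
      ENNReal.ofReal_toReal (ENNReal.toReal_pos_iff.1 hF0).2.ne
    have hGt : ENNReal.ofReal G = ∫⁻ x, g x :=
      ENNReal.ofReal_toReal (ENNReal.toReal_pos_iff.1 hG0).2.ne
    rw [← hFt, ← hGt, ← ENNReal.ofReal_mul (by positivity), ← ENNReal.ofReal_mul (by positivity),
      ← ENNReal.ofReal_mul (by positivity), ← ENNReal.ofReal_mul (by positivity),
      ← ENNReal.ofReal_add (by positivity) (by positivity)] at this
    simpa [div_eq_inv_mul] using this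
  calc ENNReal.ofReal (genMean (bblIndex 1 p) lam F G)
      ≤ ENNReal.ofReal (M * ((1 - lam) * (F / A) + lam * (G / B))) := by
        refine ENNReal.ofReal_le_ofReal ?_
        simpa [mul_div_cancel₀ _ hA0.ne', mul_div_cancel₀ _ hB0.ne'] using
          genMean_bblIndex_one_mul_le hlam hp hA0 hB0 (div_pos hF0 hA0) (div_pos hG0 hB0)
    _ = ENNReal.ofReal M * ENNReal.ofReal ((1 - lam) * (F / A) + lam * (G / B)) :=
        ENNReal.ofReal_mul hM0.le
    _ ≤ ENNReal.ofReal M * ((ENNReal.ofReal M)⁻¹ * ∫⁻ x, h x) := by gcongr; exact hint.trans hkh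
    _ = ∫⁻ x, h x := by
        rw [← mul_assoc, ENNReal.mul_inv_cancel (by simp [hM0]) (by simp), one_mul]

theorem satisfiesBBL_real (hlam : lam ∈ Set.Ioo (0 : ℝ) 1) {p : EReal}
    (hp : ((-1 : ℝ) : EReal) ≤ p) : SatisfiesBBL ℝ lam p (bblIndex 1 p) := by
  intro f g hf hg h hh H
  set F := (∫⁻ x, f x).toReal with hF
  set G := (∫⁻ x, g x).toReal with hG
  have hFn : 0 ≤ F := ENNReal.toReal_nonneg
  rcases hFn.eq_or_lt with hF0 | hF0
  · simp [← hF0, genMean_zero_left]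
  have hGn : 0 ≤ G := ENNReal.toReal_nonneg
  rcases hGn.eq_or_lt with hG0 | hG0
  · simp [← hG0, genMean_zero_right]
  have approx : ∀ {u : ℝ → ℝ≥0}, 0 < (∫⁻ x, u x).toReal → ∀ {c : ℝ}, c < 1 →
      ∃ v : SimpleFunc ℝ ℝ≥0, (∀ x, v x ≤ u x) ∧
        c * (∫⁻ x, u x).toReal ≤ (∫⁻ x, v x).toReal := by
    intro u hu c hc
    have : ENNReal.ofReal (c * (∫⁻ x, u x).toReal) < ∫⁻ x, u x := by
      rw [← ENNReal.ofReal_toReal (ENNReal.toReal_pos_iff.1 hu).2.ne]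
      rw [ENNReal.toReal_ofReal hu.le, ENNReal.ofReal_lt_ofReal_iff hu]
      exact mul_lt_of_lt_one_left hu hc
    obtain ⟨v, hv, hvt, hlt⟩ := exists_lt_lintegral_simpleFunc_of_lt_lintegral this
    exact ⟨v, hv, (ENNReal.ofReal_le_iff_le_toReal hvt.ne).1 hlt.le⟩
  have hbdd : ∀ v : SimpleFunc ℝ ℝ≥0, BddAbove (Set.range v) := fun v =>
    v.finite_range.bddAbove
  have main : ∀ c : ℝ, 0 < c → c < 1 →
      ENNReal.ofReal (c * genMean (bblIndex 1 p) lam F G) ≤ ∫⁻ x, h x := by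
    intro c hc0 hc1
    obtain ⟨v, hv, hvF⟩ := approx hF0 hc1
    obtain ⟨w, hw, hwG⟩ := approx hG0 hc1
    refine le_trans (ENNReal.ofReal_le_ofReal ?_) (satisfiesBBL_real_of_bounded hlam hp
      v.measurable w.measurable (hbdd v) (hbdd w) hh fun x y =>
        (ENNReal.ofReal_le_ofReal (genMean_mono hlam p (v x).coe_nonneg (w y).coe_nonneg
          (hv x) (hw y))).trans (H x y))
    rw [← genMean_mul hlam _ hc0.le hF0.le hG0.le]
    exact genMean_mono hlam _ (mul_nonneg hc0.le hFn) (mul_nonneg hc0.le hGn) hvF hwG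
  have hcont : Filter.Tendsto (fun c : ℝ => ENNReal.ofReal (c * genMean (bblIndex 1 p) lam F G))
      (nhdsWithin 1 (Set.Iio 1)) (nhds (ENNReal.ofReal (1 * genMean (bblIndex 1 p) lam F G))) :=
    ((ENNReal.continuous_ofReal.comp (continuous_mul_const _)).tendsto _).mono_left nhdsWithin_le_nhds
  rw [one_mul] at hcont
  refine le_of_tendsto hcont ?_
  filter_upwards [Ioo_mem_nhdsLT (zero_lt_one' ℝ)] with c hc using main c hc.1 hc.2

theorem SatisfiesBBL.prod {E E' : Type*} [MeasureSpace E] [AddCommGroup E] [Module ℝ E]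
    [MeasureSpace E'] [AddCommGroup E'] [Module ℝ E'] [SFinite (volume : Measure E')]
    {p q r : EReal} (hE : SatisfiesBBL E lam q r) (hE' : SatisfiesBBL E' lam p q) :
    SatisfiesBBL (E × E') lam p r := by
  intro f g hf hg h hh H
  have toReal_eq : ∀ {u : E × E' → ℝ≥0}, Measurable u → ∫⁻ z, u z ≠ ∞ →
      ∫⁻ x, ((∫⁻ y, u (x, y)).toNNReal : ℝ≥0∞) = ∫⁻ z, u z := by
    intro u hu hut
    have hum : Measurable fun z => (u z : ℝ≥0∞) := by fun_prop
    have e : ∫⁻ z, u z = ∫⁻ x, ∫⁻ y, u (x, y) := lintegral_prod _ hum.aemeasurable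
    rw [e] at hut ⊢
    refine lintegral_congr_ae ?_
    filter_upwards [ae_lt_top hum.lintegral_prod_right' hut] with x hx
    exact ENNReal.coe_toNNReal hx.ne
  by_cases hft : ∫⁻ z, f z = ∞
  · simp [hft, genMean_zero_left]
  by_cases hgt : ∫⁻ z, g z = ∞
  · simp [hgt, genMean_zero_right]
  have key := hE (fun x => (∫⁻ y, f (x, y)).toNNReal) (fun x => (∫⁻ y, g (x, y)).toNNReal)
    (Measurable.lintegral_prod_right' (f := fun z => (f z : ℝ≥0∞)) (by fun_prop)).ennreal_toNNReal
    (Measurable.lintegral_prod_right' (f := fun z => (g z : ℝ≥0∞)) (by fun_prop)).ennreal_toNNReal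
    (fun x => ∫⁻ y, h (x, y)) hh.lintegral_prod_right' fun x x' =>
      hE' (fun y => f (x, y)) (fun y => g (x', y)) (by fun_prop) (by fun_prop)
        (fun y => h ((1 - lam) • x + lam • x', y)) (by fun_prop) fun y y' => H (x, y) (x', y')
  rw [toReal_eq hf hft, toReal_eq hg hgt] at key
  exact key.trans_eq (lintegral_prod _ hh.aemeasurable).symm

theorem SatisfiesBBL.of_measurableEquiv {E E' : Type*} [MeasureSpace E] [AddCommGroup E]
    [Module ℝ E] [MeasureSpace E'] [AddCommGroup E'] [Module ℝ E'] {p q : EReal}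
    (hE : SatisfiesBBL E lam p q) (e : E' ≃ᵐ E) (he : MeasurePreserving e)
    (hadd : ∀ x y, e (x + y) = e x + e y) (hsmul : ∀ (c : ℝ) x, e (c • x) = c • e x) :
    SatisfiesBBL E' lam p q := by
  intro f g hf hg h hh H
  have key := hE (f ∘ e.symm) (g ∘ e.symm) (hf.comp e.symm.measurable) (hg.comp e.symm.measurable)
    (h ∘ e.symm) (hh.comp e.symm.measurable) fun x y => by
      have hxy : e.symm ((1 - lam) • x + lam • y)
          = (1 - lam) • e.symm x + lam • e.symm y := by
        rw [MeasurableEquiv.symm_apply_eq]; simp [hadd, hsmul]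
      simpa [hxy] using H (e.symm x) (e.symm y)
  have hint : ∀ {u : E' → ℝ≥0∞}, Measurable u → ∫⁻ x, u (e.symm x) = ∫⁻ x, u x :=
    fun hu => he.symm.lintegral_comp hu
  simp only [Function.comp_apply] at key
  rwa [hint (u := fun x => f x) (by fun_prop), hint (u := fun x => g x) (by fun_prop),
    hint hh] at key

theorem satisfiesBBL_pi (hlam : lam ∈ Set.Ioo (0 : ℝ) 1) {n : ℕ} (hn : 1 ≤ n) {p : EReal}
    (hp : ((-(1 / n) : ℝ) : EReal) ≤ p) : SatisfiesBBL (Fin n → ℝ) lam p (bblIndex n p) := by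
  induction n, hn using Nat.le_induction with
  | base =>
    refine (satisfiesBBL_real hlam (by simpa using hp)).of_measurableEquiv
      (MeasurableEquiv.funUnique (Fin 1) ℝ) (volume_preserving_funUnique (Fin 1) ℝ)
      (fun x y => rfl) fun c x => rfl
  | succ n hn ih =>
    obtain ⟨hge, heq⟩ := bblIndex_one_bblIndex hn hp
    have hp' : ((-(1 / n) : ℝ) : EReal) ≤ p := by
      refine le_trans (EReal.coe_le_coe_iff.2 ?_) hp
      have : (0 : ℝ) < n := by exact_mod_cast hn
      gcongr
      simp
    rw [← heq]
    exact ((satisfiesBBL_real hlam hge).prod (ih hp')).of_measurableEquiv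
      (MeasurableEquiv.piFinSuccAbove (fun _ => ℝ) 0)
      (volume_preserving_piFinSuccAbove (fun _ => ℝ) 0) (fun x y => rfl) fun c x => rfl

end Functional

theorem exists_measurable_nnreal_le {α : Type*} [MeasurableSpace α] (μ : Measure α) {f : α → ℝ}
    (hf : ∀ x, 0 ≤ f x) (hfi : Integrable f μ) :
    ∃ u : α → ℝ≥0, Measurable u ∧ (∀ x, u x ≤ f x) ∧ (∫⁻ x, u x ∂μ).toReal = ∫ x, f x ∂μ := by
  obtain ⟨u, hu, huf, hint⟩ := exists_measurable_le_lintegral_eq (μ := μ)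
    fun x => ENNReal.ofReal (f x)
  have hut : ∀ x, u x ≠ ∞ := fun x => ne_top_of_le_ne_top ENNReal.ofReal_ne_top (huf x)
  refine ⟨fun x => (u x).toNNReal, hu.ennreal_toNNReal, fun x => ?_, ?_⟩
  · exact ENNReal.toReal_le_of_le_ofReal (hf x) (huf x)
  · simp only [ENNReal.coe_toNNReal (hut _)]
    rw [← hint, integral_eq_lintegral_of_nonneg_ae (Filter.Eventually.of_forall hf)
      hfi.aestronglyMeasurable]

theorem AEMeasurable.exists_measurable_ge {α : Type*} [MeasurableSpace α] {μ : Measure α}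
    {f : α → ℝ≥0∞} (hf : AEMeasurable f μ) :
    ∃ u : α → ℝ≥0∞, Measurable u ∧ f ≤ u ∧ ∫⁻ x, u x ∂μ = ∫⁻ x, f x ∂μ := by
  obtain ⟨t, hts, ht, ht0⟩ := exists_measurable_superset_of_null (ae_iff.1 hf.ae_eq_mk)
  classical
  refine ⟨t.piecewise (fun _ => ∞) (hf.mk f), measurable_const.piecewise ht hf.measurable_mk,
    fun x => ?_, lintegral_congr_ae ?_⟩
  · by_cases hx : x ∈ t
    · simp [hx]
    · have : f x = hf.mk f x := by_contra fun h => hx (hts h)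
      simp [hx, this]
  · filter_upwards [measure_eq_zero_iff_ae_notMem.1 ht0, hf.ae_eq_mk] with x hx hfx
    simp [hx, hfx]

/-- **Borell–Brascamp–Lieb inequality.** Let `n ≥ 1`, `0 < λ < 1`, `−1/n ≤ p ≤ +∞`, and
let `f, g, h ∈ L¹(ℝⁿ)` be nonnegative with `h((1−λ)x + λy) ≥ M_p(f(x), g(y); λ)` for all
`x, y ∈ ℝⁿ`. Then `∫ h ≥ M_{p/(np+1)}(∫ f, ∫ g; λ)`. -/
theorem borell_brascamp_lieb (n : ℕ) (hn : 1 ≤ n)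
    (lam : ℝ) (hlam : lam ∈ Set.Ioo (0 : ℝ) 1)
    (p : EReal) (hp : ((-(1 / n) : ℝ) : EReal) ≤ p)
    (f g h : (Fin n → ℝ) → ℝ)
    (hf0 : ∀ x, 0 ≤ f x) (hg0 : ∀ x, 0 ≤ g x) (hh0 : ∀ x, 0 ≤ h x)
    (hfi : Integrable f) (hgi : Integrable g) (hhi : Integrable h)
    (hyp : ∀ x y : Fin n → ℝ, genMean p lam (f x) (g y) ≤ h ((1 - lam) • x + lam • y)) :
    genMean (bblIndex n p) lam (∫ x, f x) (∫ x, g x) ≤ ∫ x, h x := by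
  obtain ⟨u, hu, huf, hu_int⟩ := exists_measurable_nnreal_le volume hf0 hfi
  obtain ⟨v, hv, hvg, hv_int⟩ := exists_measurable_nnreal_le volume hg0 hgi
  obtain ⟨w, hw, hhw, hw_int⟩ := hhi.aemeasurable.ennreal_ofReal.exists_measurable_ge
  have key := satisfiesBBL_pi hlam hn hp u v hu hv w hw fun x y =>
    (ENNReal.ofReal_le_ofReal ((genMean_mono hlam p (by positivity) (by positivity)
      (huf x) (hvg y)).trans (hyp x y))).trans (hhw _)
  rw [hu_int, hv_int, hw_int, ← ofReal_integral_eq_lintegral_ofReal hhi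
    (Filter.Eventually.of_forall hh0)] at key
  exact (ENNReal.ofReal_le_ofReal_iff (integral_nonneg hh0)).1 key
end

section
/- BBL inequality for p = 1/s with s a positive integer: Let n and s be positive integers, λ ∈ (0,1), and let f, g, h : ℝⁿ → [0,∞) be integrable functions with ∫ f > 0 and ∫ g > 0. Assume that for every x₀ ∈ supp(f) and x₁ ∈ supp(g), h((1−λ)x₀ + λx₁) ≥ ((1−λ)f(x₀)^{1/s} + λ g(x₁)^{1/s})^s. Then (∫_{ℝⁿ} h dx)^{1/(n+s)} ≥ (1−λ)(∫_{ℝⁿ} f dx)^{1/(n+s)} + λ(∫_{ℝⁿ} g dx)^{1/(n+s)}. -/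
open MeasureTheory

open scoped ENNReal Pointwise

theorem Real.volume_add_le_of_isCompact {K L : Set ℝ} (hK : IsCompact K) (hL : IsCompact L)
    (hK₀ : K.Nonempty) (hL₀ : L.Nonempty) : volume K + volume L ≤ volume (K + L) := by
  obtain ⟨a, haK, ha⟩ := hK.exists_isGreatest hK₀
  obtain ⟨b, hbL, hb⟩ := hL.exists_isLeast hL₀
  have h₁ : volume ((fun x => -b + x) ⁻¹' K) = volume K := measure_preimage_add _ _ _
  have h₂ : volume ((fun x => -a + x) ⁻¹' L) = volume L := measure_preimage_add _ _ _
  rw [← h₁, ← h₂, ← measure_union₀]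
  · refine measure_mono (Set.union_subset ?_ ?_)
    · intro x hx
      exact ⟨-b + x, hx, b, hbL, by ring⟩
    · intro x hx
      exact ⟨a, haK, -a + x, hx, by ring⟩
  · exact (hL.measurableSet.preimage (measurable_const_add _)).nullMeasurableSet
  · refine measure_mono_null (t := {a + b}) ?_ (by simp)
    rintro x ⟨hx, hy⟩
    have h₃ := ha hx
    have h₄ := hb hy
    simp only [Set.mem_singleton_iff]
    linarith

theorem Real.volume_add_le {A B : Set ℝ} (hA : MeasurableSet A) (hB : MeasurableSet B)
    (hA₀ : A.Nonempty) (hB₀ : B.Nonempty) : volume A + volume B ≤ volume (A + B) := by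
  obtain ⟨a, ha⟩ := hA₀
  obtain ⟨b, hb⟩ := hB₀
  refine le_of_forall_lt fun c hc => ?_
  have hcompact : ∀ {S : Set ℝ} {x : ℝ}, MeasurableSet S → x ∈ S → ∀ r < volume S,
      ∃ K ⊆ S, IsCompact K ∧ K.Nonempty ∧ r < volume K := by
    intro S x hS hx r hr
    obtain ⟨K, hKS, hK, hrK⟩ := hS.exists_lt_isCompact hr
    exact ⟨insert x K, Set.insert_subset hx hKS, hK.insert x, Set.insert_nonempty _ _,
      hrK.trans_le (measure_mono (Set.subset_insert _ _))⟩
  have key : ∀ K ⊆ A, IsCompact K → K.Nonempty → ∀ L ⊆ B, IsCompact L → L.Nonempty →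
      volume K + volume L ≤ volume (A + B) := fun K hKA hK hK₀ L hLB hL hL₀ =>
    (volume_add_le_of_isCompact hK hL hK₀ hL₀).trans (measure_mono (Set.add_subset_add hKA hLB))
  rcases eq_or_ne (volume A) 0 with h0 | hA0
  · rw [h0, zero_add] at hc
    obtain ⟨L, hLB, hL, hL₀, hcL⟩ := hcompact hB hb c hc
    exact hcL.trans_le (le_add_self.trans
      (key {a} (by simpa using ha) isCompact_singleton (by simp) L hLB hL hL₀))
  rcases eq_or_ne (volume B) 0 with h0 | hB0
  · rw [h0, add_zero] at hc
    obtain ⟨K, hKA, hK, hK₀, hcK⟩ := hcompact hA ha c hc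
    exact hcK.trans_le (le_self_add.trans
      (key K hKA hK hK₀ {b} (by simpa using hb) isCompact_singleton (by simp)))
  obtain ⟨r, hr, q, hq, hrq⟩ := ENNReal.exists_lt_add_of_lt_add hc hA0 hB0
  obtain ⟨K, hKA, hK, hK₀, hrK⟩ := hcompact hA ha r hr
  obtain ⟨L, hLB, hL, hL₀, hqL⟩ := hcompact hB hb q hq
  exact hrq.trans ((ENNReal.add_lt_add hrK hqL).trans_le (key K hKA hK hK₀ L hLB hL hL₀))

theorem Real.ofReal_mul_volume_add_le {A B : Set ℝ} (hA : MeasurableSet A) (hB : MeasurableSet B)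
    (hA₀ : A.Nonempty) (hB₀ : B.Nonempty) {α β : ℝ} (hα : 0 < α) (hβ : 0 < β) :
    ENNReal.ofReal α * volume A + ENNReal.ofReal β * volume B ≤ volume (α • A + β • B) := by
  have h := Real.volume_add_le (hA.const_smul₀ α) (hB.const_smul₀ β)
    (hA₀.smul_set (a := α)) (hB₀.smul_set (a := β))
  simpa [Measure.addHaar_smul, abs_of_pos hα, abs_of_pos hβ] using h

theorem ENNReal.lintegral_eq_lintegral_meas_lt {Ω : Type*} [MeasurableSpace Ω] (μ : Measure Ω)
    {f : Ω → ℝ≥0∞} (hf : Measurable f) (hf' : ∀ x, f x ≠ ∞) :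
    ∫⁻ x, f x ∂μ = ∫⁻ t in Set.Ioi (0 : ℝ), μ {x | ENNReal.ofReal t < f x} := by
  calc ∫⁻ x, f x ∂μ = ∫⁻ x, ENNReal.ofReal (f x).toReal ∂μ := by
        simp only [ENNReal.ofReal_toReal (hf' _)]
    _ = ∫⁻ t in Set.Ioi (0 : ℝ), μ {x | t < (f x).toReal} :=
        MeasureTheory.lintegral_eq_lintegral_meas_lt μ
          (Filter.Eventually.of_forall fun _ => ENNReal.toReal_nonneg) hf.ennreal_toReal.aemeasurable
    _ = _ := by
        refine setLIntegral_congr_fun measurableSet_Ioi fun t ht => ?_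
        simp only [ENNReal.ofReal_lt_iff_lt_toReal (le_of_lt ht) (hf' _)]

theorem ENNReal.lintegral_eq_lintegral_meas_le {Ω : Type*} [MeasurableSpace Ω] (μ : Measure Ω)
    {f : Ω → ℝ≥0∞} (hf : Measurable f) (hf' : ∀ x, f x ≠ ∞) :
    ∫⁻ x, f x ∂μ = ∫⁻ t in Set.Ioi (0 : ℝ), μ {x | ENNReal.ofReal t ≤ f x} := by
  calc ∫⁻ x, f x ∂μ = ∫⁻ x, ENNReal.ofReal (f x).toReal ∂μ := by
        simp only [ENNReal.ofReal_toReal (hf' _)]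
    _ = ∫⁻ t in Set.Ioi (0 : ℝ), μ {x | t ≤ (f x).toReal} :=
        MeasureTheory.lintegral_eq_lintegral_meas_le μ
          (Filter.Eventually.of_forall fun _ => ENNReal.toReal_nonneg) hf.ennreal_toReal.aemeasurable
    _ = _ := by
        simp only [ENNReal.ofReal_le_iff_le_toReal (hf' _)]

/-- The one-dimensional Prékopa–Leindler inequality in its additive form, for functions of
supremum one. -/
theorem lintegral_add_le_of_iSup_eq_one {u v w : ℝ → ℝ≥0∞} (hu : Measurable u) (hv : Measurable v)
    (hw : Measurable w) (hu₁ : ⨆ x, u x = 1) (hv₁ : ⨆ x, v x = 1) (hw₁ : ∀ x, w x ≤ 1)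
    {α β : ℝ} (hα : 0 < α) (hβ : 0 < β)
    (H : ∀ t < 1, ∀ x y, t < u x → t < v y → t ≤ w (α * x + β * y)) :
    ENNReal.ofReal α * (∫⁻ x, u x) + ENNReal.ofReal β * (∫⁻ x, v x) ≤ ∫⁻ x, w x := by
  have hu_le : ∀ x, u x ≤ 1 := fun x => hu₁ ▸ le_iSup u x
  have hv_le : ∀ x, v x ≤ 1 := fun x => hv₁ ▸ le_iSup v x
  rw [ENNReal.lintegral_eq_lintegral_meas_lt volume hu fun x => ((hu_le x).trans_lt (by simp)).ne,
    ENNReal.lintegral_eq_lintegral_meas_lt volume hv fun x => ((hv_le x).trans_lt (by simp)).ne,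
    ENNReal.lintegral_eq_lintegral_meas_le volume hw fun x => ((hw₁ x).trans_lt (by simp)).ne,
    ← lintegral_const_mul' _ _ ENNReal.ofReal_ne_top,
    ← lintegral_const_mul' _ _ ENNReal.ofReal_ne_top]
  refine (le_lintegral_add _ _).trans (lintegral_mono fun t => ?_)
  rcases lt_or_ge (ENNReal.ofReal t) 1 with ht | ht
  · obtain ⟨x, hx⟩ := lt_iSup_iff.1 (hu₁ ▸ ht)
    obtain ⟨y, hy⟩ := lt_iSup_iff.1 (hv₁ ▸ ht)
    refine (Real.ofReal_mul_volume_add_le (measurableSet_lt measurable_const hu)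
      (measurableSet_lt measurable_const hv) ⟨x, hx⟩ ⟨y, hy⟩ hα hβ).trans (measure_mono ?_)
    rintro _ ⟨_, ⟨x, hx, rfl⟩, _, ⟨y, hy, rfl⟩, rfl⟩
    exact H _ ht x y hx hy
  · simp [fun x => ((hu_le x).trans ht).not_gt, fun x => ((hv_le x).trans ht).not_gt]

theorem ENNReal.add_mul_rpow_le {s : ℝ} (hs : 0 < s) (α β a b A B : ℝ≥0∞) :
    α * (a * A) ^ (1 / (1 + s)) + β * (b * B) ^ (1 / (1 + s)) ≤
      ((α * a ^ (1 / s) + β * b ^ (1 / s)) ^ s) ^ (1 / (1 + s)) *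
        (α * A + β * B) ^ (1 / (1 + s)) := by
  have hs₁ : 0 < 1 + s := by positivity
  have hpq : ((1 + s) / s).HolderConjugate (1 + s) := by
    rw [Real.holderConjugate_iff]
    refine ⟨by rw [lt_div_iff₀ hs]; linarith, by field_simp; ring⟩
  have key := ENNReal.inner_le_Lp_mul_Lq Finset.univ
    ![α ^ (s / (1 + s)) * a ^ (1 / (1 + s)), β ^ (s / (1 + s)) * b ^ (1 / (1 + s))]
    ![α ^ (1 / (1 + s)) * A ^ (1 / (1 + s)), β ^ (1 / (1 + s)) * B ^ (1 / (1 + s))] hpq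
  simp only [Fin.sum_univ_two, Matrix.cons_val_zero, Matrix.cons_val_one] at key
  have h₁ : ∀ x X y : ℝ≥0∞, x ^ (s / (1 + s)) * y ^ (1 / (1 + s)) *
      (x ^ (1 / (1 + s)) * X ^ (1 / (1 + s))) = x * (y * X) ^ (1 / (1 + s)) := by
    intro x X y
    rw [mul_mul_mul_comm, ← ENNReal.rpow_add_of_nonneg _ _ (by positivity) (by positivity),
      ← ENNReal.mul_rpow_of_nonneg _ _ (by positivity),
      show s / (1 + s) + 1 / (1 + s) = 1 by field_simp; ring, ENNReal.rpow_one]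
  have h₂ : ∀ x y : ℝ≥0∞, (x ^ (s / (1 + s)) * y ^ (1 / (1 + s))) ^ ((1 + s) / s) =
      x * y ^ (1 / s) := by
    intro x y
    rw [ENNReal.mul_rpow_of_nonneg _ _ (by positivity), ← ENNReal.rpow_mul, ← ENNReal.rpow_mul,
      show s / (1 + s) * ((1 + s) / s) = 1 by field_simp,
      show 1 / (1 + s) * ((1 + s) / s) = 1 / s by field_simp, ENNReal.rpow_one]
  have h₃ : ∀ x y : ℝ≥0∞, (x ^ (1 / (1 + s)) * y ^ (1 / (1 + s))) ^ (1 + s) = x * y := by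
    intro x y
    rw [← ENNReal.mul_rpow_of_nonneg _ _ (by positivity), ← ENNReal.rpow_mul,
      one_div_mul_cancel hs₁.ne', ENNReal.rpow_one]
  rw [h₁, h₁, h₂, h₂, h₃, h₃] at key
  rwa [← ENNReal.rpow_mul, mul_one_div, ← one_div_div (1 + s) s]

theorem borell_brascamp_lieb_real_of_bounded {s : ℝ} (hs : 0 < s) {f g h : ℝ → ℝ≥0∞}
    (hf : Measurable f) (hg : Measurable g) (hh : Measurable h)
    (hf₀ : ⨆ x, f x ≠ 0) (hg₀ : ⨆ x, g x ≠ 0) (hf₁ : ⨆ x, f x ≠ ∞) (hg₁ : ⨆ x, g x ≠ ∞)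
    {α β : ℝ} (hα : 0 < α) (hβ : 0 < β)
    (H : ∀ x y, f x ≠ 0 → g y ≠ 0 → ENNReal.ofReal α * f x ^ (1 / s) +
      ENNReal.ofReal β * g y ^ (1 / s) ≤ h (α * x + β * y) ^ (1 / s)) :
    ENNReal.ofReal α * (∫⁻ x, f x) ^ (1 / (1 + s)) + ENNReal.ofReal β * (∫⁻ x, g x) ^ (1 / (1 + s))
      ≤ (∫⁻ x, h x) ^ (1 / (1 + s)) := by
  set a := ⨆ x, f x with ha
  set b := ⨆ x, g x with hb
  set m := (ENNReal.ofReal α * a ^ (1 / s) + ENNReal.ofReal β * b ^ (1 / s)) ^ s with hm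
  have hs' : 0 < 1 / s := by positivity
  have hm₀ : m ≠ 0 := by
    simp [hm, ENNReal.rpow_eq_zero_iff, hα, hf₀, hs, hs.le, hf₁]
  have hm₁ : m ≠ ∞ :=
    ENNReal.rpow_ne_top_of_nonneg hs.le <| ENNReal.add_ne_top.2
      ⟨ENNReal.mul_ne_top ENNReal.ofReal_ne_top (ENNReal.rpow_ne_top_of_nonneg hs'.le hf₁),
       ENNReal.mul_ne_top ENNReal.ofReal_ne_top (ENNReal.rpow_ne_top_of_nonneg hs'.le hg₁)⟩
  have key := lintegral_add_le_of_iSup_eq_one (u := fun x => f x / a) (v := fun x => g x / b)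
    (w := fun x => min (h x / m) 1) (hf.div_const _) (hg.div_const _)
    ((hh.div_const _).min measurable_const)
    (by rw [← ENNReal.iSup_div, ← ha, ENNReal.div_self hf₀ hf₁])
    (by rw [← ENNReal.iSup_div, ← hb, ENNReal.div_self hg₀ hg₁])
    (fun x => min_le_right _ _) hα hβ (by
      intro t ht x y hx hy
      refine le_min ?_ ht.le
      rw [ENNReal.lt_div_iff_mul_lt (.inl hf₀) (.inl hf₁)] at hx
      rw [ENNReal.lt_div_iff_mul_lt (.inl hg₀) (.inl hg₁)] at hy
      rw [ENNReal.le_div_iff_mul_le (.inl hm₀) (.inl hm₁), ← ENNReal.rpow_le_rpow_iff hs']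
      refine le_trans ?_ (H x y (pos_of_gt hx).ne' (pos_of_gt hy).ne')
      rw [ENNReal.mul_rpow_of_nonneg _ _ hs'.le, hm, ← ENNReal.rpow_mul, mul_one_div_cancel hs.ne',
        ENNReal.rpow_one, mul_add, mul_left_comm, mul_left_comm (t ^ (1 / s)),
        ← ENNReal.mul_rpow_of_nonneg _ _ hs'.le, ← ENNReal.mul_rpow_of_nonneg _ _ hs'.le]
      gcongr)
  have key₂ := key.trans (lintegral_mono fun x => min_le_left _ _)
  simp only [div_eq_mul_inv] at key₂
  rw [lintegral_mul_const (μ := volume) _ hf, lintegral_mul_const (μ := volume) _ hg,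
    lintegral_mul_const (μ := volume) _ hh] at key₂
  have hcancel : ∀ {c : ℝ≥0∞}, c ≠ 0 → c ≠ ∞ → ∀ F : ℝ≥0∞, c * (F * c⁻¹) = F := by
    intro c hc₀ hc₁ F
    rw [mul_left_comm, ENNReal.mul_inv_cancel hc₀ hc₁, mul_one]
  have holder := ENNReal.add_mul_rpow_le hs (ENNReal.ofReal α) (ENNReal.ofReal β) a b
    ((∫⁻ x, f x) * a⁻¹) ((∫⁻ x, g x) * b⁻¹)
  rw [hcancel hf₀ hf₁, hcancel hg₀ hg₁, ← hm,
    ← ENNReal.mul_rpow_of_nonneg _ _ (by positivity)] at holder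
  refine holder.trans (ENNReal.rpow_le_rpow ?_ (by positivity))
  calc m * _ ≤ m * ((∫⁻ x, h x) * m⁻¹) := by gcongr
    _ = _ := hcancel hm₀ hm₁ _

theorem borell_brascamp_lieb_real {s : ℝ} (hs : 0 < s) {f g h : ℝ → ℝ≥0∞}
    (hf : Measurable f) (hg : Measurable g) (hh : Measurable h)
    (hf₀ : ∫⁻ x, f x ≠ 0) (hg₀ : ∫⁻ x, g x ≠ 0) {α β : ℝ} (hα : 0 < α) (hβ : 0 < β)
    (H : ∀ x y, f x ≠ 0 → g y ≠ 0 → ENNReal.ofReal α * f x ^ (1 / s) +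
      ENNReal.ofReal β * g y ^ (1 / s) ≤ h (α * x + β * y) ^ (1 / s)) :
    ENNReal.ofReal α * (∫⁻ x, f x) ^ (1 / (1 + s)) + ENNReal.ofReal β * (∫⁻ x, g x) ^ (1 / (1 + s))
      ≤ (∫⁻ x, h x) ^ (1 / (1 + s)) := by
  have hlim : ∀ {φ : ℝ → ℝ≥0∞}, Measurable φ → ∀ c : ℝ≥0∞, c ≠ ∞ → Filter.Tendsto
      (fun k : ℕ => c * (∫⁻ x, min (φ x) (k + 1 : ℕ)) ^ (1 / (1 + s))) Filter.atTop
      (nhds (c * (∫⁻ x, φ x) ^ (1 / (1 + s)))) := by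
    intro φ hφ c hc
    refine ENNReal.Tendsto.const_mul ?_ (.inr hc)
    refine (ENNReal.continuous_rpow_const.tendsto _).comp ?_
    refine lintegral_tendsto_of_tendsto_of_monotone
      (fun k => (hφ.min measurable_const).aemeasurable) (.of_forall fun x k l hkl => ?_)
      (.of_forall fun x => ?_)
    · exact min_le_min_left _ (by exact_mod_cast Nat.succ_le_succ hkl)
    · have := (tendsto_const_nhds (x := φ x)).min
        (ENNReal.tendsto_nat_nhds_top.comp (Filter.tendsto_add_atTop_nat 1))
      simpa using this
  refine le_of_tendsto' ((hlim hf _ ENNReal.ofReal_ne_top).add (hlim hg _ ENNReal.ofReal_ne_top))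
    fun k => ?_
  have hsup : ∀ {φ : ℝ → ℝ≥0∞}, ∫⁻ x, φ x ≠ 0 → ⨆ x, min (φ x) (k + 1 : ℕ) ≠ 0 := by
    intro φ hφ h0
    refine hφ ?_
    have : ∀ x, φ x = 0 := by simpa using h0
    simp [this]
  have htop : ∀ φ : ℝ → ℝ≥0∞, ⨆ x, min (φ x) (k + 1 : ℕ) ≠ ∞ := fun φ =>
    ((iSup_le fun x => min_le_right _ _).trans_lt (ENNReal.natCast_lt_top (k + 1))).ne
  refine borell_brascamp_lieb_real_of_bounded hs (hf.min measurable_const)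
    (hg.min measurable_const) hh (hsup hf₀) (hsup hg₀) (htop f) (htop g) hα hβ fun x y hx hy => ?_
  refine le_trans ?_ (H x y (fun h0 => hx (by simp [h0])) (fun h0 => hy (by simp [h0])))
  gcongr <;> exact min_le_left _ _

theorem lintegral_fin_succ {n : ℕ} {f : (Fin (n + 1) → ℝ) → ℝ≥0∞} (hf : Measurable f) :
    ∫⁻ x, f x = ∫⁻ x : Fin n → ℝ, ∫⁻ t : ℝ, f (Fin.cons t x) := by
  have e := (volume_preserving_piFinSuccAbove (fun _ : Fin (n + 1) => ℝ) 0).symm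
  rw [MeasurePreserving.lintegral_map_equiv f _ e, Measure.volume_eq_prod]
  refine (lintegral_prod_symm _ (hf.comp (MeasurableEquiv.measurable _)).aemeasurable).trans ?_
  simp [MeasurableEquiv.piFinSuccAbove_symm_apply, Fin.insertNthEquiv]

theorem measurable_finCons {n : ℕ} :
    Measurable fun p : (Fin n → ℝ) × ℝ => (Fin.cons p.2 p.1 : Fin (n + 1) → ℝ) := by
  rw [measurable_pi_iff]
  intro i
  refine Fin.cases ?_ (fun j => ?_) i
  · simpa using measurable_snd
  · simpa [Function.comp_def] using (measurable_pi_apply j).comp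
      (measurable_fst (α := Fin n → ℝ) (β := ℝ))

theorem borell_brascamp_lieb_lintegral (n : ℕ) {s : ℝ} (hs : 0 < s) {f g h : (Fin n → ℝ) → ℝ≥0∞}
    (hf : Measurable f) (hg : Measurable g) (hh : Measurable h)
    (hf₀ : ∫⁻ x, f x ≠ 0) (hg₀ : ∫⁻ x, g x ≠ 0) {α β : ℝ} (hα : 0 < α) (hβ : 0 < β)
    (H : ∀ x y, f x ≠ 0 → g y ≠ 0 → ENNReal.ofReal α * f x ^ (1 / s) +
      ENNReal.ofReal β * g y ^ (1 / s) ≤ h (α • x + β • y) ^ (1 / s)) :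
    ENNReal.ofReal α * (∫⁻ x, f x) ^ (1 / (n + s)) + ENNReal.ofReal β * (∫⁻ x, g x) ^ (1 / (n + s))
      ≤ (∫⁻ x, h x) ^ (1 / (n + s)) := by
  induction n generalizing s with
  | zero =>
    simp only [Measure.volume_pi_eq_dirac (default : Fin 0 → ℝ), lintegral_dirac] at hf₀ hg₀ ⊢
    have := H default default hf₀ hg₀
    rwa [Subsingleton.elim (α • default + β • default) (default : Fin 0 → ℝ),
      show s = ((0 : ℕ) : ℝ) + s by simp] at this
  | succ n ih =>
    rw [lintegral_fin_succ hf] at hf₀ ⊢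
    rw [lintegral_fin_succ hg] at hg₀ ⊢
    rw [lintegral_fin_succ hh]
    have hmeas : ∀ {φ : (Fin (n + 1) → ℝ) → ℝ≥0∞}, Measurable φ →
        Measurable fun x : Fin n → ℝ => ∫⁻ t : ℝ, φ (Fin.cons t x) := fun hφ =>
      Measurable.lintegral_prod_right (hφ.comp measurable_finCons)
    have hfib : ∀ {φ : (Fin (n + 1) → ℝ) → ℝ≥0∞}, Measurable φ → ∀ x : Fin n → ℝ,
        Measurable fun t : ℝ => φ (Fin.cons t x) := fun hφ x =>
      hφ.comp (measurable_finCons.comp measurable_prodMk_left)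
    have key := ih (s := 1 + s) (by positivity) (hmeas hf) (hmeas hg) (hmeas hh) hf₀ hg₀
      fun x y hx hy => ?_
    · rwa [show ((n + 1 : ℕ) : ℝ) + s = n + (1 + s) by push_cast; ring]
    · refine borell_brascamp_lieb_real hs (hfib hf x) (hfib hg y) (hfib hh _) hx hy hα hβ
        fun t u ht hu => ?_
      convert H _ _ ht hu using 3
      ext i
      refine Fin.cases ?_ (fun j => ?_) i <;> simp

theorem AEMeasurable.exists_measurable_ge_ae_eq {Ω : Type*} [MeasurableSpace Ω] {μ : Measure Ω}
    {f : Ω → ℝ≥0∞} (hf : AEMeasurable f μ) : ∃ g, Measurable g ∧ f ≤ g ∧ f =ᵐ[μ] g := by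
  classical
  obtain ⟨N, hN, hNm, hN₀⟩ := exists_measurable_superset_of_null (ae_iff.1 hf.ae_eq_mk)
  refine ⟨N.piecewise (fun _ => ∞) (hf.mk f), measurable_const.piecewise hNm hf.measurable_mk,
    fun x => ?_, ?_⟩
  · by_cases hx : x ∈ N
    · simp [hx]
    · simpa [hx] using (not_not.1 fun h => hx (hN h) : f x = hf.mk f x).le
  · filter_upwards [hf.ae_eq_mk, compl_mem_ae_iff.2 hN₀] with x hx hxN
    rw [Set.piecewise_eq_of_notMem _ _ _ hxN, hx]

/-- **Borell–Brascamp–Lieb inequality for `p = 1/s` with `s` a positive integer.**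
Let `n` and `s` be positive integers, `λ ∈ (0,1)`, and let `f, g, h : ℝⁿ → [0,∞)` be
integrable with `∫ f > 0` and `∫ g > 0`. If
`h((1−λ)x₀ + λx₁) ≥ ((1−λ)f(x₀)^{1/s} + λ g(x₁)^{1/s})^s` for every `x₀ ∈ supp(f)` and
`x₁ ∈ supp(g)`, then `(∫ h)^{1/(n+s)} ≥ (1−λ)(∫ f)^{1/(n+s)} + λ(∫ g)^{1/(n+s)}`. -/
theorem bbl_integer_index (n s : ℕ) (hn : 0 < n) (hs : 0 < s)
    (lam : ℝ) (hlam : lam ∈ Set.Ioo (0 : ℝ) 1)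
    (f g h : (Fin n → ℝ) → ℝ)
    (hf0 : ∀ x, 0 ≤ f x) (hg0 : ∀ x, 0 ≤ g x) (hh0 : ∀ x, 0 ≤ h x)
    (hfi : Integrable f) (hgi : Integrable g) (hhi : Integrable h)
    (hF : 0 < ∫ x, f x) (hG : 0 < ∫ x, g x)
    (hyp : ∀ x₀ ∈ closure {x | 0 < f x}, ∀ x₁ ∈ closure {x | 0 < g x},
      ((1 - lam) * f x₀ ^ ((1 : ℝ) / s) + lam * g x₁ ^ ((1 : ℝ) / s)) ^ (s : ℝ)
        ≤ h ((1 - lam) • x₀ + lam • x₁)) :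
    (1 - lam) * (∫ x, f x) ^ ((1 : ℝ) / (n + s)) + lam * (∫ x, g x) ^ ((1 : ℝ) / (n + s))
      ≤ (∫ x, h x) ^ ((1 : ℝ) / (n + s)) := by
  obtain ⟨hl₀, hl₁⟩ := hlam
  have hl₁' : 0 < 1 - lam := by linarith
  have hs' : (0 : ℝ) < s := by exact_mod_cast hs
  have hns : (0 : ℝ) ≤ 1 / (n + s) := by positivity
  have eF := ofReal_integral_eq_lintegral_ofReal hfi (.of_forall hf0)
  have eG := ofReal_integral_eq_lintegral_ofReal hgi (.of_forall hg0)
  have eH := ofReal_integral_eq_lintegral_ofReal hhi (.of_forall hh0)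
  obtain ⟨f₁, hf₁, hf_le, hf_eq⟩ := exists_measurable_le_lintegral_eq volume
    (fun x => ENNReal.ofReal (f x))
  obtain ⟨g₁, hg₁, hg_le, hg_eq⟩ := exists_measurable_le_lintegral_eq volume
    (fun x => ENNReal.ofReal (g x))
  obtain ⟨h₁, hh₁, hh_le, hh_eq⟩ := hhi.aemeasurable.ennreal_ofReal.exists_measurable_ge_ae_eq
  rw [hf_eq] at eF
  rw [hg_eq] at eG
  rw [lintegral_congr_ae hh_eq] at eH
  have key := borell_brascamp_lieb_lintegral n hs' hf₁ hg₁ hh₁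
    (by rw [← eF]; simpa using hF) (by rw [← eG]; simpa using hG) hl₁' hl₀ fun x y hx hy => ?_
  · have hF' := Real.rpow_nonneg hF.le (1 / (n + s : ℝ))
    have hG' := Real.rpow_nonneg hG.le (1 / (n + s : ℝ))
    rw [← eF, ← eG, ← eH, ENNReal.ofReal_rpow_of_nonneg hF.le hns,
      ENNReal.ofReal_rpow_of_nonneg hG.le hns,
      ENNReal.ofReal_rpow_of_nonneg (integral_nonneg hh0) hns,
      ← ENNReal.ofReal_mul hl₁'.le, ← ENNReal.ofReal_mul hl₀.le,
      ← ENNReal.ofReal_add (mul_nonneg hl₁'.le hF') (mul_nonneg hl₀.le hG')] at key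
    exact (ENNReal.ofReal_le_ofReal_iff (Real.rpow_nonneg (integral_nonneg hh0) _)).1 key
  · have hs'' : (0 : ℝ) ≤ 1 / s := by positivity
    have hx' : 0 < f x := ENNReal.ofReal_pos.1 ((pos_iff_ne_zero.2 hx).trans_le (hf_le x))
    have hy' : 0 < g y := ENNReal.ofReal_pos.1 ((pos_iff_ne_zero.2 hy).trans_le (hg_le y))
    have hf' := Real.rpow_nonneg (hf0 x) (1 / (s : ℝ))
    have hg' := Real.rpow_nonneg (hg0 y) (1 / (s : ℝ))
    have hfg := add_nonneg (mul_nonneg hl₁'.le hf') (mul_nonneg hl₀.le hg')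
    have hxy := Real.rpow_le_rpow (Real.rpow_nonneg hfg _)
      (hyp x (subset_closure hx') y (subset_closure hy')) hs''
    rw [← Real.rpow_mul hfg, mul_one_div_cancel hs'.ne', Real.rpow_one] at hxy
    calc _ ≤ ENNReal.ofReal (1 - lam) * ENNReal.ofReal (f x) ^ (1 / (s : ℝ)) +
          ENNReal.ofReal lam * ENNReal.ofReal (g y) ^ (1 / (s : ℝ)) := by
          gcongr
          · exact hf_le x
          · exact hg_le y
      _ = ENNReal.ofReal ((1 - lam) * f x ^ (1 / (s : ℝ)) + lam * g y ^ (1 / (s : ℝ))) := by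
          rw [ENNReal.ofReal_rpow_of_nonneg (hf0 x) hs'', ENNReal.ofReal_rpow_of_nonneg (hg0 y) hs'',
            ← ENNReal.ofReal_mul hl₁'.le, ← ENNReal.ofReal_mul hl₀.le,
            ← ENNReal.ofReal_add (mul_nonneg hl₁'.le hf') (mul_nonneg hl₀.le hg')]
      _ ≤ ENNReal.ofReal (h ((1 - lam) • x + lam • y)) ^ (1 / (s : ℝ)) := by
          rw [ENNReal.ofReal_rpow_of_nonneg (hh0 _) hs'']
          exact ENNReal.ofReal_le_ofReal hxy
      _ ≤ _ := ENNReal.rpow_le_rpow (hh_le _) hs''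
end

section
/- Inclusion of Minkowski combinations of graph bodies for rational s: Let n be a positive integer, s = p/q with p, q coprime positive integers, λ ∈ (0,1), and let f, g : ℝⁿ → [0,∞) be integrable with ∫ f > 0 and ∫ g > 0. Let h_λ be the (1/s, λ)-supremal convolution of f and g, and let h : ℝⁿ → [0,∞) satisfy h((1−λ)x₀ + λx₁) ≥ ((1−λ)f(x₀)^{1/s} + λ g(x₁)^{1/s})^s for all x₀ ∈ supp(f), x₁ ∈ supp(g). Then, with W = (1−λ)W_{f,s} + λW_{g,s}, it holds that W ⊆ W_{h_λ,s} ⊆ W_{h,s}. -/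
open MeasureTheory
open scoped Pointwise Classical BigOperators

/-- The body `W_{f,s} ⊂ (ℝⁿ)^q × ℝᵖ` (for `s = p/q`):
`{(x₁,…,x_q,y) : x_j ∈ supp(f) ∀j, |y| ≤ ∏_j f(x_j)^{1/p}}`. -/
def Wbody (n p q : ℕ) (f : EuclideanSpace ℝ (Fin n) → ℝ) :
    Set ((Fin q → EuclideanSpace ℝ (Fin n)) × EuclideanSpace ℝ (Fin p)) :=
  {z | (∀ j, z.1 j ∈ closure {x | 0 < f x}) ∧
    ‖z.2‖ ≤ ∏ j, f (z.1 j) ^ (1 / (p : ℝ))}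

/-- The `(1/s, λ)`-supremal convolution of `f` and `g`. -/
noncomputable def supConv (n : ℕ) (s lam : ℝ) (f g : EuclideanSpace ℝ (Fin n) → ℝ)
    (z : EuclideanSpace ℝ (Fin n)) : ℝ :=
  if z ∈ (1 - lam) • closure {x | 0 < f x} + lam • closure {x | 0 < g x} then
    sSup {t | ∃ x ∈ closure {x | 0 < f x}, ∃ y ∈ closure {x | 0 < g x},
      z = (1 - lam) • x + lam • y ∧
      t = ((1 - lam) * f x ^ (1 / s) + lam * g y ^ (1 / s)) ^ s}
  else 0

/-- **Mahler's inequality**: the geometric mean is superadditive on nonnegative tuples. -/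
theorem prod_rpow_add_prod_rpow_le {q : ℕ} (hq : 0 < q) (u v : Fin q → ℝ)
    (hu : ∀ j, 0 ≤ u j) (hv : ∀ j, 0 ≤ v j) :
    ∏ j, u j ^ (1 / (q : ℝ)) + ∏ j, v j ^ (1 / (q : ℝ)) ≤ ∏ j, (u j + v j) ^ (1 / (q : ℝ)) := by
  have hq' : (0 : ℝ) < q := by exact_mod_cast hq
  have hq0 : (1 : ℝ) / q ≠ 0 := by positivity
  by_cases hz : ∃ j, u j + v j = 0
  · obtain ⟨j, hj⟩ := hz
    have h1 : u j = 0 := by linarith [hu j, hv j]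
    have h2 : v j = 0 := by linarith [hu j, hv j]
    rw [Finset.prod_eq_zero (Finset.mem_univ j) (by rw [h1, Real.zero_rpow hq0]),
      Finset.prod_eq_zero (Finset.mem_univ j) (by rw [h2, Real.zero_rpow hq0]), add_zero]
    exact Finset.prod_nonneg fun i _ => Real.rpow_nonneg (add_nonneg (hu i) (hv i)) _
  · push Not at hz
    have hpos : ∀ j, 0 < u j + v j := fun j =>
      lt_of_le_of_ne (add_nonneg (hu j) (hv j)) (hz j).symm
    have amgm : ∀ w : Fin q → ℝ, (∀ j, 0 ≤ w j) →
        ∏ j, w j ^ (1 / (q : ℝ)) ≤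
          (∑ j, 1 / (q : ℝ) * (w j / (u j + v j))) * ∏ j, (u j + v j) ^ (1 / (q : ℝ)) := by
      intro w hw
      have h := Real.geom_mean_le_arith_mean_weighted Finset.univ
        (fun _ : Fin q => 1 / (q : ℝ)) (fun j => w j / (u j + v j))
        (fun _ _ => by positivity) (by simp [hq'.ne'])
        (fun j _ => div_nonneg (hw j) (hpos j).le)
      calc ∏ j, w j ^ (1 / (q : ℝ))
          = (∏ j, (w j / (u j + v j)) ^ (1 / (q : ℝ))) * ∏ j, (u j + v j) ^ (1 / (q : ℝ)) := by
            rw [← Finset.prod_mul_distrib]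
            refine Finset.prod_congr rfl fun j _ => ?_
            rw [← Real.mul_rpow (div_nonneg (hw j) (hpos j).le) (hpos j).le,
              div_mul_cancel₀ _ (hz j)]
        _ ≤ _ := mul_le_mul_of_nonneg_right h
            (Finset.prod_nonneg fun i _ => Real.rpow_nonneg (hpos i).le _)
    have hsum : (∑ j, 1 / (q : ℝ) * (u j / (u j + v j)))
        + (∑ j, 1 / (q : ℝ) * (v j / (u j + v j))) = 1 := by
      rw [← Finset.sum_add_distrib]
      have : ∀ j, 1 / (q : ℝ) * (u j / (u j + v j)) + 1 / (q : ℝ) * (v j / (u j + v j))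
          = 1 / (q : ℝ) := fun j => by
        rw [← mul_add, ← add_div, div_self (hz j), mul_one]
      rw [Finset.sum_congr rfl fun j _ => this j]
      simp [hq'.ne']
    calc _ ≤ _ := add_le_add (amgm u hu) (amgm v hv)
      _ = _ := by rw [← add_mul, hsum, one_mul]

/-- A convex combination of products is at most the product of the power means. -/
theorem convex_comb_prod_le {p q : ℕ} (hp : 0 < p) (hq : 0 < q) {lam : ℝ}
    (h0 : 0 ≤ lam) (h1 : lam ≤ 1) (a b : Fin q → ℝ) (ha : ∀ j, 0 ≤ a j) (hb : ∀ j, 0 ≤ b j) :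
    (1 - lam) * ∏ j, a j ^ (1 / (p : ℝ)) + lam * ∏ j, b j ^ (1 / (p : ℝ)) ≤
      ∏ j, (((1 - lam) * a j ^ (1 / ((p : ℝ) / q)) + lam * b j ^ (1 / ((p : ℝ) / q)))
        ^ ((p : ℝ) / q)) ^ (1 / (p : ℝ)) := by
  have hp' : (p : ℝ) ≠ 0 := by exact_mod_cast hp.ne'
  have hq' : (q : ℝ) ≠ 0 := by exact_mod_cast hq.ne'
  have key : ∀ c : ℝ, 0 ≤ c → ∀ w : Fin q → ℝ, (∀ j, 0 ≤ w j) →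
      c * ∏ j, w j ^ (1 / (p : ℝ)) =
        ∏ j, (c * w j ^ (1 / ((p : ℝ) / q))) ^ (1 / (q : ℝ)) := by
    intro c hc w hw
    have e : ∀ j, (c * w j ^ (1 / ((p : ℝ) / q))) ^ (1 / (q : ℝ))
        = c ^ (1 / (q : ℝ)) * w j ^ (1 / (p : ℝ)) := fun j => by
      rw [Real.mul_rpow hc (Real.rpow_nonneg (hw j) _), ← Real.rpow_mul (hw j)]
      congr 2
      field_simp
    simp_rw [e]
    rw [Finset.prod_mul_distrib, Finset.prod_const, Finset.card_univ, Fintype.card_fin,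
      ← Real.rpow_mul_natCast hc, one_div_mul_cancel hq', Real.rpow_one]
  have hc : 0 ≤ 1 - lam := by linarith
  rw [key _ hc a ha, key _ h0 b hb]
  refine (prod_rpow_add_prod_rpow_le hq _ _
    (fun j => mul_nonneg hc (Real.rpow_nonneg (ha j) _))
    (fun j => mul_nonneg h0 (Real.rpow_nonneg (hb j) _))).trans_eq ?_
  refine Finset.prod_congr rfl fun j _ => ?_
  rw [← Real.rpow_mul (add_nonneg (mul_nonneg hc (Real.rpow_nonneg (ha j) _))
    (mul_nonneg h0 (Real.rpow_nonneg (hb j) _)))]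
  congr 1
  field_simp

/-- `supConv` is nonnegative. -/
theorem supConv_nonneg {n : ℕ} {s lam : ℝ} (h0 : 0 ≤ lam) (h1 : lam ≤ 1)
    {f g : EuclideanSpace ℝ (Fin n) → ℝ} (hf : ∀ x, 0 ≤ f x) (hg : ∀ x, 0 ≤ g x)
    (z : EuclideanSpace ℝ (Fin n)) : 0 ≤ supConv n s lam f g z := by
  unfold supConv
  split_ifs
  · refine Real.sSup_nonneg ?_
    rintro t ⟨x, -, y, -, -, rfl⟩
    exact Real.rpow_nonneg (add_nonneg (mul_nonneg (sub_nonneg.2 h1) (Real.rpow_nonneg (hf x) _))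
      (mul_nonneg h0 (Real.rpow_nonneg (hg y) _))) _
  · exact le_rfl

/-- `supConv` lies below every nonnegative function dominating the power means on the supports. -/
theorem supConv_le {n : ℕ} {s lam : ℝ} {f g h : EuclideanSpace ℝ (Fin n) → ℝ}
    (hh : ∀ x, 0 ≤ h x)
    (hyp : ∀ x₀ ∈ closure {x | 0 < f x}, ∀ x₁ ∈ closure {x | 0 < g x},
      ((1 - lam) * f x₀ ^ (1 / s) + lam * g x₁ ^ (1 / s)) ^ s ≤ h ((1 - lam) • x₀ + lam • x₁))
    (z : EuclideanSpace ℝ (Fin n)) : supConv n s lam f g z ≤ h z := by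
  unfold supConv
  split_ifs
  · refine Real.sSup_le ?_ (hh z)
    rintro t ⟨x, hx, y, hy, rfl, rfl⟩
    exact hyp x hx y hy
  · exact hh z

/-- If the power means are bounded by a function of the combined point, `supConv` dominates them. -/
theorem le_supConv {n : ℕ} {s lam : ℝ} {f g h : EuclideanSpace ℝ (Fin n) → ℝ}
    (hyp : ∀ x₀ ∈ closure {x | 0 < f x}, ∀ x₁ ∈ closure {x | 0 < g x},
      ((1 - lam) * f x₀ ^ (1 / s) + lam * g x₁ ^ (1 / s)) ^ s ≤ h ((1 - lam) • x₀ + lam • x₁))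
    {x y : EuclideanSpace ℝ (Fin n)}
    (hx : x ∈ closure {x | 0 < f x}) (hy : y ∈ closure {x | 0 < g x}) :
    ((1 - lam) * f x ^ (1 / s) + lam * g y ^ (1 / s)) ^ s ≤
      supConv n s lam f g ((1 - lam) • x + lam • y) := by
  unfold supConv
  rw [if_pos (Set.add_mem_add (Set.smul_mem_smul_set hx) (Set.smul_mem_smul_set hy))]
  refine le_csSup ⟨h ((1 - lam) • x + lam • y), ?_⟩ ⟨x, hx, y, hy, rfl, rfl⟩
  rintro t ⟨x', hx', y', hy', hz, rfl⟩
  rw [hz]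
  exact hyp x' hx' y' hy'

/-- **Inclusion of Minkowski combinations of graph bodies for rational `s`.**
Let `s = p/q` with `p, q` coprime positive integers, `λ ∈ (0,1)`, and `f, g` integrable
nonnegative with positive integrals. If `h` satisfies the BBL hypothesis of index `1/s`
on the supports, then `W := (1−λ)W_{f,s} + λW_{g,s}` satisfies
`W ⊆ W_{h_λ,s} ⊆ W_{h,s}`, where `h_λ` is the `(1/s,λ)`-supremal convolution. -/
theorem Wbody_inclusions (n p q : ℕ) (hn : 0 < n) (hp : 0 < p) (hq : 0 < q)
    (hpq : Nat.Coprime p q) (lam : ℝ) (hlam : lam ∈ Set.Ioo (0 : ℝ) 1)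
    (f g h : EuclideanSpace ℝ (Fin n) → ℝ)
    (hf0 : ∀ x, 0 ≤ f x) (hg0 : ∀ x, 0 ≤ g x) (hh0 : ∀ x, 0 ≤ h x)
    (hfi : Integrable f) (hgi : Integrable g)
    (hF : 0 < ∫ x, f x) (hG : 0 < ∫ x, g x)
    (hyp : ∀ x₀ ∈ closure {x | 0 < f x}, ∀ x₁ ∈ closure {x | 0 < g x},
      ((1 - lam) * f x₀ ^ (1 / ((p : ℝ) / q)) + lam * g x₁ ^ (1 / ((p : ℝ) / q)))
          ^ ((p : ℝ) / q)
        ≤ h ((1 - lam) • x₀ + lam • x₁)) :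
    (1 - lam) • Wbody n p q f + lam • Wbody n p q g
        ⊆ Wbody n p q (supConv n ((p : ℝ) / q) lam f g) ∧
    Wbody n p q (supConv n ((p : ℝ) / q) lam f g) ⊆ Wbody n p q h := by
  have hl0 : 0 < lam := hlam.1
  have hl1 : 0 < 1 - lam := sub_pos.2 hlam.2
  have hsc := supConv_nonneg (s := (p : ℝ) / q) hl0.le hlam.2.le hf0 hg0
  constructor
  · rintro _ ⟨_, ⟨⟨x, y⟩, ⟨hx, hxy⟩, rfl⟩, _, ⟨⟨x', y'⟩, ⟨hx', hxy'⟩, rfl⟩, rfl⟩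
    refine ⟨fun j => ?_, ?_⟩
    · refine map_mem_closure₂ (f := fun a b => (1 - lam) • a + lam • b) (by fun_prop)
        (hx j) (hx' j) fun a ha b hb => ?_
      refine lt_of_lt_of_le ?_ (le_supConv hyp (subset_closure ha) (subset_closure hb))
      have ha' : 0 < f a := ha
      have hb' : 0 < g b := hb
      positivity
    · calc ‖(1 - lam) • y + lam • y'‖
          ≤ ‖(1 - lam) • y‖ + ‖lam • y'‖ := norm_add_le _ _
        _ = (1 - lam) * ‖y‖ + lam * ‖y'‖ := by
            rw [norm_smul_of_nonneg hl1.le, norm_smul_of_nonneg hl0.le]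
        _ ≤ (1 - lam) * ∏ j, f (x j) ^ (1 / (p : ℝ)) +
              lam * ∏ j, g (x' j) ^ (1 / (p : ℝ)) :=
            add_le_add (mul_le_mul_of_nonneg_left hxy hl1.le)
              (mul_le_mul_of_nonneg_left hxy' hl0.le)
        _ ≤ _ := convex_comb_prod_le hp hq hl0.le hlam.2.le _ _
            (fun j => hf0 _) (fun j => hg0 _)
        _ ≤ _ := by
            have hpow : ∀ j, 0 ≤ ((1 - lam) * f (x j) ^ (1 / ((p : ℝ) / q)) +
                lam * g (x' j) ^ (1 / ((p : ℝ) / q))) ^ ((p : ℝ) / q) := fun j => by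
              have := hf0 (x j)
              have := hg0 (x' j)
              positivity
            exact Finset.prod_le_prod (fun j _ => Real.rpow_nonneg (hpow j) _) fun j _ =>
              Real.rpow_le_rpow (hpow j) (le_supConv hyp (hx j) (hx' j)) (by positivity)
  · rintro ⟨x, y⟩ ⟨hx, hxy⟩
    have hle := supConv_le hh0 hyp
    refine ⟨fun j => closure_mono (fun a ha => lt_of_lt_of_le ha (hle a)) (hx j),
      hxy.trans ?_⟩
    exact Finset.prod_le_prod (fun j _ => Real.rpow_nonneg (hsc _) _) fun j _ =>
      Real.rpow_le_rpow (hsc _) (hle _) (by positivity)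
end

section
/- Concavity of the section-radius function of a convex set: Let n, s be positive integers and let C ⊂ ℝ^{n+s} = ℝⁿ × ℝˢ be a bounded convex set. For x̄ ∈ ℝⁿ let C(x̄) = {y ∈ ℝˢ : (x̄, y) ∈ C} and r_C(x̄) = (ω_s^{−1}|C(x̄)|)^{1/s}. Then for every t ∈ (0,1) and every x₀, x₁ ∈ ℝⁿ such that C(x₀) and C(x₁) are nonempty, it holds that (1−t)r_C(x₀) + t r_C(x₁) ≤ r_C((1−t)x₀ + t x₁). -/
open MeasureTheory

/-- `ω_s`: the Lebesgue measure of the unit ball in `ℝˢ`. -/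
noncomputable def unitBallVol (s : ℕ) : ℝ :=
  (volume (Metric.ball (0 : EuclideanSpace ℝ (Fin s)) 1)).toReal

/-- The section-radius function: `r_C(x̄) = (ω_s⁻¹ |C(x̄)|)^{1/s}`, where
`C(x̄) = {y ∈ ℝˢ : (x̄, y) ∈ C}`. -/
noncomputable def sectionRadius (n s : ℕ)
    (C : Set (EuclideanSpace ℝ (Fin n) × EuclideanSpace ℝ (Fin s)))
    (x : EuclideanSpace ℝ (Fin n)) : ℝ :=
  ((unitBallVol s)⁻¹ * (volume {y | (x, y) ∈ C}).toReal) ^ (1 / (s : ℝ))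

open Pointwise in
/-- The one-dimensional Brunn–Minkowski inequality. -/
theorem Real.volume_add_volume_le_of_add_subset {A B C : Set ℝ} (hA : MeasurableSet A)
    (hB : MeasurableSet B) (hA₀ : A.Nonempty) (hB₀ : B.Nonempty) (hC : A + B ⊆ C) :
    volume A + volume B ≤ volume C := by
  have compact_le : ∀ K ⊆ A, ∀ L ⊆ B, IsCompact K → IsCompact L → K.Nonempty → L.Nonempty →
      volume K + volume L ≤ volume C := by
    intro K hKA L hLB hK hL hK₀ hL₀
    obtain ⟨k, hkK, hk⟩ := hK.exists_isGreatest hK₀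
    obtain ⟨l, hlL, hl⟩ := hL.exists_isLeast hL₀
    have hdisj : AEDisjoint volume ((fun x ↦ l + x) '' K) ((fun x ↦ k + x) '' L) := by
      refine measure_mono_null (t := {k + l}) ?_ (by simp)
      rintro _ ⟨⟨x, hx, rfl⟩, ⟨y, hy, hxy⟩⟩
      have := hk hx
      have := hl hy
      simp only [Set.mem_singleton_iff] at *
      linarith
    have hmeas : MeasurableSet ((fun x ↦ k + x) '' L) :=
      (hL.image (continuous_const.add continuous_id)).measurableSet
    calc volume K + volume L
        = volume ((fun x ↦ l + x) '' K ∪ (fun x ↦ k + x) '' L) := by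
          rw [measure_union₀ hmeas.nullMeasurableSet hdisj]
          simp only [Set.image_add_left, measure_preimage_add]
      _ ≤ volume C := by
          refine measure_mono (subset_trans (Set.union_subset ?_ ?_) hC)
          · rintro _ ⟨x, hx, rfl⟩
            exact ⟨x, hKA hx, l, hLB hlL, add_comm _ _⟩
          · rintro _ ⟨y, hy, rfl⟩
            exact ⟨k, hKA hkK, y, hLB hy, rfl⟩
  obtain ⟨a, ha⟩ := hA₀
  obtain ⟨b, hb⟩ := hB₀
  rw [hA.measure_eq_iSup_isCompact, hB.measure_eq_iSup_isCompact]
  simp only [iSup_and']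
  refine ENNReal.biSup_add_biSup_le' ⟨∅, by simp⟩ ⟨∅, by simp⟩
    fun K ⟨hKA, hK⟩ L ⟨hLB, hL⟩ ↦ ?_
  calc volume K + volume L ≤ volume (insert a K) + volume (insert b L) := by
        gcongr <;> exact Set.subset_insert _ _
    _ ≤ volume C := compact_le _ (Set.insert_subset ha hKA) _ (Set.insert_subset hb hLB)
        (hK.insert a) (hL.insert b) (Set.insert_nonempty _ _) (Set.insert_nonempty _ _)

/-- The layer cake formula for a function truncated at `1`. -/
theorem lintegral_min_one_eq_lintegral_meas_lt {α : Type*} [MeasurableSpace α] (μ : Measure α)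
    {φ : α → ENNReal} (hφ : Measurable φ) :
    ∫⁻ x, min (φ x) 1 ∂μ = ∫⁻ l in Set.Ioo (0 : ℝ) 1, μ {x | ENNReal.ofReal l < φ x} := by
  have htop : ∀ x, min (φ x) 1 ≠ ⊤ := fun x ↦
    ne_top_of_le_ne_top ENNReal.one_ne_top (min_le_right _ _)
  have h := lintegral_eq_lintegral_meas_lt (f := fun x ↦ (min (φ x) 1).toReal) μ
    (.of_forall fun _ ↦ ENNReal.toReal_nonneg) (by fun_prop)
  simp only [ENNReal.ofReal_toReal (htop _)] at h
  rw [h, ← Set.Ioo_union_Ici_eq_Ioi zero_lt_one,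
    lintegral_union measurableSet_Ici (Set.disjoint_left.2 fun x hx hx' ↦ hx.2.not_ge hx'),
    setLIntegral_congr_fun (g := fun _ ↦ 0) measurableSet_Ici, lintegral_zero, add_zero]
  · refine setLIntegral_congr_fun measurableSet_Ioo fun l hl ↦ ?_
    simp only [← ENNReal.ofReal_lt_iff_lt_toReal hl.1.le (htop _), lt_min_iff]
    simp [hl.2]
  · intro l hl
    simp only [← ENNReal.ofReal_lt_iff_lt_toReal (zero_le_one.trans hl) (htop _), lt_min_iff]
    simp [not_lt.2 (Set.mem_Ici.1 hl)]

open Pointwise in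
/-- The Prékopa–Leindler inequality on `ℝ` in additive form, for functions with supremum `1`. -/
theorem lintegral_add_le_lintegral_of_rpow_mul_rpow_le {p q : ℝ} (hp : 0 < p) (hq : 0 < q)
    (hpq : p + q = 1) {F G H : ℝ → ENNReal} (hF : Measurable F) (hG : Measurable G)
    (hH : Measurable H) (hF₁ : ⨆ x, F x = 1) (hG₁ : ⨆ x, G x = 1)
    (h : ∀ x y, F x ^ p * G y ^ q ≤ H (p * x + q * y)) :
    ENNReal.ofReal p * (∫⁻ x, F x) + ENNReal.ofReal q * (∫⁻ x, G x) ≤ ∫⁻ x, H x := by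
  have hFmin : ∀ x, min (F x) 1 = F x := fun x ↦ min_eq_left (hF₁ ▸ le_iSup F x)
  have hGmin : ∀ x, min (G x) 1 = G x := fun x ↦ min_eq_left (hG₁ ▸ le_iSup G x)
  have hanti : ∀ φ : ℝ → ENNReal, Measurable fun l : ℝ ↦ volume {x | ENNReal.ofReal l < φ x} :=
    fun φ ↦ Antitone.measurable fun l m hlm ↦ measure_mono fun x hx ↦
      (ENNReal.ofReal_le_ofReal hlm).trans_lt hx
  have hFlayer := lintegral_min_one_eq_lintegral_meas_lt volume hF
  have hGlayer := lintegral_min_one_eq_lintegral_meas_lt volume hG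
  simp only [hFmin] at hFlayer
  simp only [hGmin] at hGlayer
  rw [hFlayer, hGlayer]
  refine le_trans ?_ ((lintegral_min_one_eq_lintegral_meas_lt volume hH).symm.le.trans
    (lintegral_mono fun x ↦ min_le_left _ _))
  rw [← lintegral_const_mul _ (hanti F), ← lintegral_const_mul _ (hanti G),
    ← lintegral_add_left ((hanti F).const_mul _)]
  refine setLIntegral_mono (hanti H) fun l hl ↦ ?_
  have hl1 : ENNReal.ofReal l < 1 := by simpa using hl.2
  have hl0 : ENNReal.ofReal l ≠ 0 := by simpa using hl.1
  have hscale : ∀ {r : ℝ}, 0 < r → ∀ S : Set ℝ, ENNReal.ofReal r * volume S = volume (r • S) := by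
    intro r hr S
    rw [Measure.addHaar_smul_of_nonneg _ hr.le]
    simp
  rw [hscale hp, hscale hq]
  refine Real.volume_add_volume_le_of_add_subset
    ((measurableSet_lt measurable_const hF).const_smul₀ _)
    ((measurableSet_lt measurable_const hG).const_smul₀ _)
    (Set.Nonempty.smul_set (lt_iSup_iff.1 (hl1.trans_eq hF₁.symm)))
    (Set.Nonempty.smul_set (lt_iSup_iff.1 (hl1.trans_eq hG₁.symm))) ?_
  rintro _ ⟨_, ⟨x, hx, rfl⟩, _, ⟨y, hy, rfl⟩, rfl⟩
  refine lt_of_lt_of_le ?_ (h x y)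
  calc ENNReal.ofReal l = ENNReal.ofReal l ^ p * ENNReal.ofReal l ^ q := by
        rw [← ENNReal.rpow_add _ _ hl0 ENNReal.ofReal_ne_top, hpq, ENNReal.rpow_one]
    _ < F x ^ p * G y ^ q :=
        ENNReal.mul_lt_mul (ENNReal.rpow_lt_rpow hx hp) (ENNReal.rpow_lt_rpow hy hq)

/-- The weighted inequality of arithmetic and geometric means for two numbers in `ℝ≥0∞`. -/
theorem ENNReal.rpow_mul_rpow_le_add {p q : ℝ} (hp : 0 < p) (hq : 0 < q) (hpq : p + q = 1)
    (a b : ENNReal) : a ^ p * b ^ q ≤ ENNReal.ofReal p * a + ENNReal.ofReal q * b := by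
  rcases eq_or_ne a ⊤ with rfl | ha
  · simp [ENNReal.mul_top, hp]
  rcases eq_or_ne b ⊤ with rfl | hb
  · simp [ENNReal.mul_top, hq]
  lift a to NNReal using ha
  lift b to NNReal using hb
  lift p to NNReal using hp.le
  lift q to NNReal using hq.le
  simp only [← ENNReal.coe_rpow_of_nonneg _ NNReal.zero_le_coe, ENNReal.ofReal_coe_nnreal]
  exact_mod_cast NNReal.geom_mean_le_arith_mean2_weighted p q a b (by exact_mod_cast hpq)

/-- The Prékopa–Leindler inequality on `ℝ`, for bounded functions. -/
theorem prekopa_leindler_real {p q : ℝ} (hp : 0 < p) (hq : 0 < q)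
    (hpq : p + q = 1) {F G H : ℝ → ENNReal} (hF : Measurable F) (hG : Measurable G)
    (hH : Measurable H) (hF₁ : ⨆ x, F x ≠ ⊤) (hG₁ : ⨆ x, G x ≠ ⊤)
    (h : ∀ x y, F x ^ p * G y ^ q ≤ H (p * x + q * y)) :
    (∫⁻ x, F x) ^ p * (∫⁻ x, G x) ^ q ≤ ∫⁻ x, H x := by
  set a := ⨆ x, F x with ha
  set b := ⨆ x, G x with hb
  rcases eq_or_ne a 0 with ha₀ | ha₀
  · have : ∀ x, F x = 0 := ENNReal.iSup_eq_zero.1 ha₀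
    simp [this, hp]
  rcases eq_or_ne b 0 with hb₀ | hb₀
  · have : ∀ x, G x = 0 := ENNReal.iSup_eq_zero.1 hb₀
    simp [this, hq]
  have ha₁ : a ^ p ≠ 0 := (ENNReal.rpow_pos (pos_iff_ne_zero.2 ha₀) hF₁).ne'
  have hb₁ : b ^ q ≠ 0 := (ENNReal.rpow_pos (pos_iff_ne_zero.2 hb₀) hG₁).ne'
  have hc₀ : a ^ p * b ^ q ≠ 0 := mul_ne_zero ha₁ hb₁
  have hc₁ : a ^ p * b ^ q ≠ ⊤ := ENNReal.mul_ne_top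
    (ENNReal.rpow_ne_top_of_nonneg hp.le hF₁) (ENNReal.rpow_ne_top_of_nonneg hq.le hG₁)
  have hinv : (a ^ p * b ^ q)⁻¹ = a⁻¹ ^ p * b⁻¹ ^ q := by
    rw [ENNReal.mul_inv (.inl ha₁) (.inr hb₁),
      ENNReal.inv_rpow, ENNReal.inv_rpow]
  have hmul : ∀ u v : ENNReal, (a⁻¹ * u) ^ p * (b⁻¹ * v) ^ q =
      (a ^ p * b ^ q)⁻¹ * (u ^ p * v ^ q) := by
    intro u v
    rw [hinv, ENNReal.mul_rpow_of_nonneg _ _ hp.le, ENNReal.mul_rpow_of_nonneg _ _ hq.le]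
    ring
  have key := lintegral_add_le_lintegral_of_rpow_mul_rpow_le hp hq hpq (hF.const_mul a⁻¹)
    (hG.const_mul b⁻¹) (hH.const_mul (a ^ p * b ^ q)⁻¹)
    (by rw [← ENNReal.mul_iSup, ← ha, ENNReal.inv_mul_cancel ha₀ hF₁])
    (by rw [← ENNReal.mul_iSup, ← hb, ENNReal.inv_mul_cancel hb₀ hG₁])
    (fun x y ↦ by rw [hmul]; gcongr; exact h x y)
  have := (ENNReal.rpow_mul_rpow_le_add hp hq hpq _ _).trans key
  rw [lintegral_const_mul _ hF, lintegral_const_mul _ hG, lintegral_const_mul _ hH, hmul] at this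
  exact (ENNReal.mul_le_mul_iff_right (ENNReal.inv_ne_zero.2 hc₁) (ENNReal.inv_ne_top.2 hc₀)).1 this

/-- The multiplicative Brunn–Minkowski inequality in `Fin n → ℝ`. -/
theorem brunn_minkowski_pi {p q : ℝ} (hp : 0 < p) (hq : 0 < q) (hpq : p + q = 1) :
    ∀ (n : ℕ) {A B D : Set (Fin n → ℝ)}, MeasurableSet A → MeasurableSet B → MeasurableSet D →
      Bornology.IsBounded A → Bornology.IsBounded B →
      (∀ x ∈ A, ∀ y ∈ B, p • x + q • y ∈ D) →
      volume A ^ p * volume B ^ q ≤ volume D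
  | 0, A, B, D, hA, hB, hD, _, _, h => by
    rcases A.eq_empty_or_nonempty with rfl | ⟨x, hx⟩
    · simp [hp]
    rcases B.eq_empty_or_nonempty with rfl | ⟨y, hy⟩
    · simp [hq]
    rw [Subsingleton.eq_univ_of_nonempty ⟨x, hx⟩, Subsingleton.eq_univ_of_nonempty ⟨y, hy⟩,
      Subsingleton.eq_univ_of_nonempty ⟨_, h x hx y hy⟩]
    have huniv : volume (Set.univ : Set (Fin 0 → ℝ)) = 1 := by
      rw [Measure.volume_pi_eq_dirac]
      exact measure_univ
    rw [huniv, ENNReal.one_rpow, ENNReal.one_rpow, mul_one]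
  | n + 1, A, B, D, hA, hB, hD, hAb, hBb, h => by
    let e := MeasurableEquiv.piFinSuccAbove (fun _ : Fin (n + 1) ↦ ℝ) 0
    have he := (volume_preserving_piFinSuccAbove (fun _ : Fin (n + 1) ↦ ℝ) 0).symm
    have hvol : ∀ {S : Set (Fin (n + 1) → ℝ)}, MeasurableSet S →
        volume S = ∫⁻ x, volume (Prod.mk x ⁻¹' (e.symm ⁻¹' S)) := by
      intro S hS
      rw [← Measure.prod_apply (e.symm.measurable hS)]
      exact (he.measure_preimage hS.nullMeasurableSet).symm
    have hmeas : ∀ {S : Set (Fin (n + 1) → ℝ)}, MeasurableSet S →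
        Measurable fun x ↦ volume (Prod.mk x ⁻¹' (e.symm ⁻¹' S)) :=
      fun hS ↦ measurable_measure_prodMk_left (e.symm.measurable hS)
    have hsec : ∀ (S : Set (Fin (n + 1) → ℝ)), Bornology.IsBounded S → ∃ R, ∀ x,
        Prod.mk x ⁻¹' (e.symm ⁻¹' S) ⊆ Metric.closedBall 0 R := by
      intro S hS
      obtain ⟨R, hR⟩ := hS.exists_norm_le
      refine ⟨R, fun x y hy ↦ ?_⟩
      rw [mem_closedBall_zero_iff]
      have h0 := (norm_nonneg _).trans (hR _ hy)
      refine (pi_norm_le_iff_of_nonneg h0).2 fun i ↦ ?_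
      simpa [e, MeasurableEquiv.piFinSuccAbove] using
        (pi_norm_le_iff_of_nonneg h0).1 (hR _ hy) i.succ
    have htop : ∀ (S : Set (Fin (n + 1) → ℝ)), Bornology.IsBounded S →
        ⨆ x, volume (Prod.mk x ⁻¹' (e.symm ⁻¹' S)) ≠ ⊤ := by
      intro S hS
      obtain ⟨R, hR⟩ := hsec S hS
      exact ne_top_of_le_ne_top measure_closedBall_lt_top.ne (iSup_le fun x ↦ measure_mono (hR x))
    rw [hvol hA, hvol hB, hvol hD]
    refine prekopa_leindler_real hp hq hpq (hmeas hA) (hmeas hB) (hmeas hD) (htop A hAb)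
      (htop B hBb) fun x y ↦ ?_
    obtain ⟨R, hR⟩ := hsec A hAb
    obtain ⟨R', hR'⟩ := hsec B hBb
    refine brunn_minkowski_pi hp hq hpq n (measurable_prodMk_left (e.symm.measurable hA))
      (measurable_prodMk_left (e.symm.measurable hB))
      (measurable_prodMk_left (e.symm.measurable hD)) (Metric.isBounded_closedBall.subset (hR x))
      (Metric.isBounded_closedBall.subset (hR' y)) fun u hu v hv ↦ ?_
    have := h _ hu _ hv
    simp only [Set.mem_preimage]
    convert this using 1
    ext i
    refine Fin.cases ?_ (fun j ↦ ?_) i <;> simp [e, MeasurableEquiv.piFinSuccAbove]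

/-- The multiplicative Brunn–Minkowski inequality in Euclidean space. -/
theorem brunn_minkowski_euclidean {p q : ℝ} (hp : 0 < p) (hq : 0 < q) (hpq : p + q = 1)
    {n : ℕ} {A B D : Set (EuclideanSpace ℝ (Fin n))} (hA : MeasurableSet A) (hB : MeasurableSet B)
    (hAb : Bornology.IsBounded A) (hBb : Bornology.IsBounded B)
    (h : ∀ x ∈ A, ∀ y ∈ B, p • x + q • y ∈ D) :
    volume A ^ p * volume B ^ q ≤ volume D := by
  let e := EuclideanSpace.equiv (Fin n) ℝ
  have he : ∀ {S : Set (EuclideanSpace ℝ (Fin n))}, MeasurableSet S →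
      volume (e.symm ⁻¹' S) = volume S := fun hS ↦
    (PiLp.volume_preserving_toLp (Fin n)).measure_preimage hS.nullMeasurableSet
  have hm : Measurable e.symm := e.symm.continuous.measurable
  have hb : ∀ {S : Set (EuclideanSpace ℝ (Fin n))}, Bornology.IsBounded S →
      Bornology.IsBounded (e.symm ⁻¹' S) := fun {S} hS ↦ by
    rw [← ContinuousLinearEquiv.image_eq_preimage_symm]
    exact e.lipschitz.isBounded_image hS
  have hD := measurableSet_toMeasurable volume D
  rw [← measure_toMeasurable D, ← he hA, ← he hB, ← he hD]
  refine brunn_minkowski_pi hp hq hpq n (hm hA) (hm hB) (hm hD) (hb hAb) (hb hBb)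
    fun x hx y hy ↦ subset_toMeasurable _ _ ?_
  simpa using h _ hx _ hy

open Pointwise in
/-- The Brunn–Minkowski inequality for bounded convex sets. -/
theorem brunn_minkowski_of_convex {p q : ℝ} (hp : 0 < p) (hq : 0 < q)
    {n : ℕ} (hn : n ≠ 0) {A B D : Set (EuclideanSpace ℝ (Fin n))} (hA : Convex ℝ A)
    (hB : Convex ℝ B) (hAb : Bornology.IsBounded A) (hBb : Bornology.IsBounded B)
    (hA₀ : A.Nonempty) (hB₀ : B.Nonempty) (hD : volume D ≠ ⊤)
    (h : ∀ x ∈ A, ∀ y ∈ B, p • x + q • y ∈ D) :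
    p * volume.real A ^ (1 / (n : ℝ)) + q * volume.real B ^ (1 / (n : ℝ)) ≤
      volume.real D ^ (1 / (n : ℝ)) := by
  have hn' : 1 / (n : ℝ) ≠ 0 := by positivity
  have hroot : ∀ {v : ℝ}, 0 ≤ v → (v ^ (1 / (n : ℝ))) ^ n = v := fun hv ↦ by
    rw [one_div, Real.rpow_inv_natCast_pow hv hn]
  have le_root : ∀ {v w : ℝ}, 0 ≤ v → 0 ≤ w → v ^ n ≤ w → v ≤ w ^ (1 / (n : ℝ)) :=
    fun hv hw hvw ↦ le_of_pow_le_pow_left₀ hn (Real.rpow_nonneg hw _) (by rwa [hroot hw])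
  have hsmul : ∀ {r : ℝ}, 0 ≤ r → ∀ S : Set (EuclideanSpace ℝ (Fin n)),
      volume.real (r • S) = r ^ n * volume.real S := fun {r} hr S ↦ by
    simp [Measure.real, Measure.addHaar_smul_of_nonneg _ hr, hr]
  have hvadd : ∀ (a : EuclideanSpace ℝ (Fin n)) (S : Set (EuclideanSpace ℝ (Fin n))),
      volume.real (a +ᵥ S) = volume.real S := fun a S ↦ by
    simp only [Measure.real, measure_vadd]
  rcases (measureReal_nonneg (μ := volume) (s := A)).eq_or_lt with hA₁ | hA₁
  · obtain ⟨a, ha⟩ := hA₀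
    rw [← hA₁, Real.zero_rpow hn', mul_zero, zero_add]
    refine le_root (by positivity) measureReal_nonneg ?_
    rw [mul_pow, hroot measureReal_nonneg, ← hsmul hq.le, ← hvadd (p • a)]
    refine measureReal_mono ?_ hD
    rintro _ ⟨_, ⟨y, hy, rfl⟩, rfl⟩
    exact h a ha y hy
  rcases (measureReal_nonneg (μ := volume) (s := B)).eq_or_lt with hB₁ | hB₁
  · obtain ⟨b, hb⟩ := hB₀
    rw [← hB₁, Real.zero_rpow hn', mul_zero, add_zero]
    refine le_root (by positivity) measureReal_nonneg ?_
    rw [mul_pow, hroot measureReal_nonneg, ← hsmul hp.le, ← hvadd (q • b)]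
    refine measureReal_mono ?_ hD
    rintro _ ⟨_, ⟨x, hx, rfl⟩, rfl⟩
    simpa [add_comm] using h x hx b hb
  set u := volume.real A ^ (1 / (n : ℝ)) with hu
  set v := volume.real B ^ (1 / (n : ℝ)) with hv
  have hu₀ : 0 < u := by positivity
  have hv₀ : 0 < v := by positivity
  have normalized : ∀ {S : Set (EuclideanSpace ℝ (Fin n))}, Convex ℝ S → 0 < volume.real S →
      volume ((volume.real S ^ (1 / (n : ℝ)))⁻¹ • interior S) = 1 := by
    intro S hS hS₀
    have h₁ := hsmul (r := (volume.real S ^ (1 / (n : ℝ)))⁻¹) (by positivity) (interior S)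
    rw [inv_pow, hroot hS₀.le,
      measureReal_congr (interior_ae_eq_of_null_frontier (hS.addHaar_frontier volume)),
      inv_mul_cancel₀ hS₀.ne'] at h₁
    exact (ENNReal.toReal_eq_one_iff _).1 h₁
  set R := p * u + q * v with hR
  have hR₀ : 0 < R := by positivity
  have key := brunn_minkowski_euclidean (p := p * u / R) (q := q * v / R) (by positivity)
    (by positivity) (by field_simp; rw [hR]) (D := R⁻¹ • D)
    (isOpen_interior.measurableSet.const_smul₀ u⁻¹) (isOpen_interior.measurableSet.const_smul₀ v⁻¹)
    ((hAb.subset interior_subset).smul₀ u⁻¹) ((hBb.subset interior_subset).smul₀ v⁻¹) (by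
      rintro _ ⟨x, hx, rfl⟩ _ ⟨y, hy, rfl⟩
      refine ⟨_, h x (interior_subset hx) y (interior_subset hy), ?_⟩
      simp only [smul_add, smul_smul]
      congr 2 <;> field_simp)
  rw [normalized hA hA₁, normalized hB hB₁, ENNReal.one_rpow, ENNReal.one_rpow, mul_one] at key
  refine le_root hR₀.le measureReal_nonneg ?_
  have h₁ : 1 ≤ volume.real (R⁻¹ • D) := by
    refine (ENNReal.ofReal_le_iff_le_toReal ?_).1 (by simpa using key)
    rw [Measure.addHaar_smul]
    exact ENNReal.mul_ne_top ENNReal.ofReal_ne_top hD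
  rwa [hsmul (by positivity), inv_pow, inv_mul_eq_div, one_le_div (by positivity)] at h₁

/-- **Concavity of the section-radius function of a convex set.** Let `C ⊂ ℝⁿ × ℝˢ` be
a bounded convex set. For every `t ∈ (0,1)` and every `x₀, x₁` with nonempty sections
`C(x₀), C(x₁)`, it holds that `(1−t)r_C(x₀) + t r_C(x₁) ≤ r_C((1−t)x₀ + t x₁)`. -/
theorem sectionRadius_concave (n s : ℕ) (hn : 0 < n) (hs : 0 < s)
    (C : Set (EuclideanSpace ℝ (Fin n) × EuclideanSpace ℝ (Fin s)))
    (hCb : Bornology.IsBounded C) (hCc : Convex ℝ C)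
    (t : ℝ) (ht : t ∈ Set.Ioo (0 : ℝ) 1)
    (x₀ x₁ : EuclideanSpace ℝ (Fin n))
    (h₀ : {y | (x₀, y) ∈ C}.Nonempty) (h₁ : {y | (x₁, y) ∈ C}.Nonempty) :
    (1 - t) * sectionRadius n s C x₀ + t * sectionRadius n s C x₁
      ≤ sectionRadius n s C ((1 - t) • x₀ + t • x₁) := by
  obtain ⟨ht₀, ht₁⟩ := ht
  have hconv : ∀ x, Convex ℝ {y | (x, y) ∈ C} := fun x y hy z hz a b ha hb hab ↦ by
    simpa [← add_smul, hab] using hCc hy hz ha hb hab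
  have hbdd : ∀ x, Bornology.IsBounded {y | (x, y) ∈ C} := fun x ↦
    hCb.image_snd.subset fun y hy ↦ ⟨_, hy, rfl⟩
  have hball : 0 ≤ (unitBallVol s)⁻¹ := inv_nonneg.2 ENNReal.toReal_nonneg
  have key := brunn_minkowski_of_convex (sub_pos.2 ht₁) ht₀ hs.ne'
    (hconv x₀) (hconv x₁) (hbdd x₀) (hbdd x₁) h₀ h₁ (hbdd ((1 - t) • x₀ + t • x₁)).measure_lt_top.ne
    fun y hy z hz ↦ hCc hy hz (sub_pos.2 ht₁).le ht₀.le (sub_add_cancel 1 t)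
  simp only [sectionRadius, Real.mul_rpow hball ENNReal.toReal_nonneg]
  calc _ = (unitBallVol s)⁻¹ ^ (1 / (s : ℝ)) * _ := by
        rw [mul_left_comm, mul_left_comm t, ← mul_add]
        rfl
    _ ≤ _ := mul_le_mul_of_nonneg_left key (Real.rpow_nonneg hball _)
end
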